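/- Let q be a power of 2 and let f ∈ F_q[X]. If there are infinitely many positive integers r such that for some finite field extension L of F_q of degree r the polynomial f, viewed in L[X] via the inclusion F_q ⊆ L, is planar on L, then f is a 2-polynomial, i.e., every i ≥ 1 with nonzero coefficient of X^i in f is a power of two. -/

import Mathlib

theorem WithTop.exists_pos_le_of_finite {S : Set (WithTop ℚ)} (hS : S.Finite)
    (hpos : ∀ t ∈ S, 0 < t) : ∃ δ : ℚ, 0 < δ ∧ ∀ t ∈ S, (δ : WithTop ℚ) ≤ t := by
  induction S, hS using Set.Finite.induction_on with
  | empty => exact ⟨1, one_pos, by simp⟩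
  | @insert a S _ _ ih =>
    obtain ⟨δ, hδ, h⟩ := ih fun t ht => hpos t (Set.mem_insert_of_mem _ ht)
    have ha := hpos a (Set.mem_insert _ _)
    induction a using WithTop.recTopCoe with
    | top => exact ⟨δ, hδ, by rintro t (rfl | ht); exacts [le_top, h t ht]⟩
    | coe a =>
      have ha' : 0 < a := by exact_mod_cast ha
      refine ⟨min δ a, lt_min hδ ha', ?_⟩
      rintro t (rfl | ht)
      · exact_mod_cast min_le_right δ a
      · exact le_trans (by exact_mod_cast min_le_left δ a) (h t ht)

theorem WithTop.exists_le_of_finite {S : Set (WithTop ℚ)} (hS : S.Finite) :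
    ∃ B : ℚ, (∀ t ∈ S, (-B : ℚ) ≤ t) ∧ ∀ t ∈ S, t ≠ ⊤ → t < (B : WithTop ℚ) := by
  induction S, hS using Set.Finite.induction_on with
  | empty => exact ⟨1, by simp⟩
  | @insert a S _ _ ih =>
    obtain ⟨B, h1, h2⟩ := ih
    induction a using WithTop.recTopCoe with
    | top =>
      refine ⟨B, ?_, ?_⟩ <;> rintro t (rfl | ht)
      exacts [le_top, h1 t ht, fun h => absurd rfl h, h2 t ht]
    | coe a =>
      have hle : B ≤ max B (|a| + 1) := le_max_left _ _
      have hle' : |a| + 1 ≤ max B (|a| + 1) := le_max_right _ _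
      refine ⟨max B (|a| + 1), ?_, ?_⟩ <;> rintro t (rfl | ht)
      · have := neg_abs_le a
        exact_mod_cast (by linarith : -(max B (|a| + 1)) ≤ a)
      · exact le_trans (by exact_mod_cast neg_le_neg hle) (h1 t ht)
      · intro _
        have := le_abs_self a
        exact_mod_cast (by linarith : a < max B (|a| + 1))
      · exact fun h => lt_of_lt_of_le (h2 t ht h) (by exact_mod_cast hle)

theorem linearIndependent_mul_pow_card_pow {K E : Type*} [Field K] [Fintype K] [Field E]
    [Algebra K E] (v : AddValuation E (WithTop ℚ))
    (hv : ∀ t : E, 0 ≤ v t → ∃ c : K, 0 < v (t - algebraMap K E c))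
    {ι κ : Type*} [Fintype ι] [Fintype κ] {w : ι → E} {g : κ → E}
    (hw : LinearIndependent K w) (hg : LinearIndependent K g) :
    ∃ r₀ : ℕ, ∀ r ≥ r₀, ∀ c : ι → κ → K,
      ∑ i, ∑ j, c i j • (w i * g j ^ Fintype.card K ^ r) = 0 → ∀ i j, c i j = 0 := by
  classical
  set q := Fintype.card K with hq
  let G : (κ → K) → E := fun c => ∑ j, c j • g j
  let W : (ι → K) → E := fun c => ∑ i, c i • w i
  let T : Set (WithTop ℚ) := (Set.range fun p : (κ → K) × (κ → K) × K =>
    v (G p.1 / G p.2.1 - algebraMap K E p.2.2)) ∩ {t | 0 < t}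
  obtain ⟨δ, hδ, hT⟩ := WithTop.exists_pos_le_of_finite (S := T)
    ((Set.finite_range _).inter_of_left _) (fun t ht => ht.2)
  obtain ⟨B, hB1, hB2⟩ := WithTop.exists_le_of_finite
    ((Set.finite_range fun c => v (W c)).union (Set.finite_range fun i => v (w i)))
  have hq1 : 1 < q := Fintype.one_lt_card
  obtain ⟨N, hN⟩ := exists_nat_gt (2 * B / δ)
  refine ⟨N, fun r hr c hc => ?_⟩
  have hQ : 2 * B < (q ^ r : ℕ) * δ := by
    rw [div_lt_iff₀ hδ] at hN
    have h1 : r < q ^ r := Nat.lt_pow_self hq1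
    have h2 : (N : ℚ) ≤ (q ^ r : ℕ) := by exact_mod_cast hr.trans h1.le
    nlinarith
  set Q := q ^ r with hQdef
  have hQ0 : Q ≠ 0 := (pow_pos (by omega) r).ne'
  have hcQ : ∀ c : K, algebraMap K E c ^ Q = algebraMap K E c := fun c => by
    rw [← map_pow, hQdef, hq, FiniteField.pow_card_pow]
  obtain ⟨p, hp⟩ := CharP.exists K
  have := hp
  obtain ⟨n, hpp, hqn⟩ := FiniteField.card K p
  have : Fact p.Prime := ⟨hpp⟩
  have : CharP E p := charP_of_injective_algebraMap (algebraMap K E).injective p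
  have hQp : Q = p ^ (n * r : ℕ) := by rw [hQdef, hq, hqn, pow_mul]
  have hsum : ∑ i, w i * G (c i) ^ Q = 0 := by
    rw [← hc]
    refine Finset.sum_congr rfl fun i _ => ?_
    rw [hQp, sum_pow_char_pow, ← hQp, Finset.mul_sum]
    refine Finset.sum_congr rfl fun j _ => ?_
    rw [Algebra.smul_def, mul_pow, hcQ, Algebra.smul_def]; ring
  have hGz : ∀ i, G (c i) = 0 → ∀ j, c i j = 0 := fun i h =>
    Fintype.linearIndependent_iff.1 hg _ h
  by_contra! hne
  obtain ⟨i₁, j₁, hij⟩ := hne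
  have hne1 : G (c i₁) ≠ 0 := fun h => hij (hGz _ h _)
  obtain ⟨i₀, -, hmin⟩ := Finset.exists_min_image Finset.univ (fun i => v (G (c i)))
    ⟨i₁, Finset.mem_univ _⟩
  have hne0 : G (c i₀) ≠ 0 := fun h => by
    have := hmin i₁ (Finset.mem_univ _)
    rw [h, AddValuation.map_zero, top_le_iff, AddValuation.top_iff] at this
    exact hne1 this
  have hnn : ∀ i, 0 ≤ v (G (c i) / G (c i₀)) := fun i => by
    have h := hmin i (Finset.mem_univ _)
    have e : v (G (c i)) = v (G (c i) / G (c i₀)) + v (G (c i₀)) := by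
      rw [← AddValuation.map_mul, div_mul_cancel₀ _ hne0]
    have hft : v (G (c i₀)) ≠ ⊤ := by rwa [Ne, AddValuation.top_iff]
    rw [e] at h
    by_contra! hlt
    have := WithTop.add_lt_add_right hft hlt
    rw [zero_add] at this
    exact absurd h (not_le.2 this)
  choose a ha using fun i => hv _ (hnn i)
  have hst : ∀ i, (δ : WithTop ℚ) ≤ v (G (c i) / G (c i₀) - algebraMap K E (a i)) := fun i =>
    hT _ ⟨⟨(c i, c i₀, a i), rfl⟩, ha i⟩
  have ha0 : a i₀ ≠ 0 := fun h => by
    have := ha i₀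
    rw [h, map_zero, sub_zero, div_self hne0, AddValuation.map_one] at this
    exact lt_irrefl _ this
  have hWa : W a = - ∑ i, w i * (G (c i) / G (c i₀) - algebraMap K E (a i)) ^ Q := by
    have h0 : ∑ i, w i * (G (c i) / G (c i₀)) ^ Q = 0 := by
      have : ∑ i, w i * (G (c i) / G (c i₀)) ^ Q =
          (∑ i, w i * G (c i) ^ Q) / G (c i₀) ^ Q := by
        rw [Finset.sum_div]
        exact Finset.sum_congr rfl fun i _ => by rw [div_pow]; ring
      rw [this, hsum, zero_div]
    rw [eq_neg_iff_add_eq_zero, ← h0, ← Finset.sum_add_distrib]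
    refine Finset.sum_congr rfl fun i _ => ?_
    rw [hQp, sub_pow_char_pow, ← hQp, hcQ, Algebra.smul_def]; ring
  have hW0 : W a ≠ 0 := fun h => ha0 (Fintype.linearIndependent_iff.1 hw _ h i₀)
  have hlt : v (W a) < B := hB2 _ (Or.inl ⟨a, rfl⟩) (by rwa [Ne, AddValuation.top_iff])
  have hge : (B : WithTop ℚ) ≤ v (W a) := by
    rw [hWa, AddValuation.map_neg]
    refine AddValuation.map_le_sum _ fun i _ => ?_
    rw [AddValuation.map_mul, AddValuation.map_pow]
    have h1 : ((-B : ℚ) : WithTop ℚ) ≤ v (w i) := hB1 _ (Or.inr ⟨i, rfl⟩)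
    have h2 : ((Q • δ : ℚ) : WithTop ℚ) ≤
        Q • v (G (c i) / G (c i₀) - algebraMap K E (a i)) := by
      rw [WithTop.coe_nsmul]; exact nsmul_le_nsmul_right (hst i) Q
    refine le_trans ?_ (add_le_add h1 h2)
    rw [← WithTop.coe_add, WithTop.coe_le_coe, nsmul_eq_mul]
    linarith
  exact absurd hge (not_le.2 hlt)
section

open Polynomial

/-- The `K`-span of the monomials `x ^ i * y ^ j` with `i < d` and `j < e`. -/
def boxSpan (K : Type*) {R : Type*} [Field K] [CommRing R] [Algebra K R] (x y : R) (e d : ℕ) :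
    Submodule K R :=
  Submodule.span K (Set.range fun p : Fin d × Fin e => x ^ (p.1 : ℕ) * y ^ (p.2 : ℕ))

section boxSpan

variable {K R : Type*} [Field K] [CommRing R] [Algebra K R] {x y : R} {e : ℕ}

instance boxSpan.finite (d : ℕ) : Module.Finite K (boxSpan K x y e d) :=
  Module.Finite.span_of_finite K (Set.finite_range _)

theorem finrank_boxSpan_le (d : ℕ) : Module.finrank K (boxSpan K x y e d) ≤ d * e := by
  refine (finrank_range_le_card (R := K) _).trans ?_
  simp

theorem monomial_mem_boxSpan {i j d : ℕ} (hi : i < d) (hj : j < e) :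
    x ^ i * y ^ j ∈ boxSpan K x y e d :=
  Submodule.subset_span ⟨(⟨i, hi⟩, ⟨j, hj⟩), rfl⟩

theorem boxSpan_le_iff {d : ℕ} {S : Submodule K R} :
    boxSpan K x y e d ≤ S ↔ ∀ i < d, ∀ j < e, x ^ i * y ^ j ∈ S := by
  rw [boxSpan, Submodule.span_le, Set.range_subset_iff]
  exact ⟨fun h i hi j hj => h (⟨i, hi⟩, ⟨j, hj⟩), fun h p => h _ p.1.2 _ p.2.2⟩

theorem boxSpan_mono {d d' : ℕ} (h : d ≤ d') : boxSpan K x y e d ≤ boxSpan K x y e d' :=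
  boxSpan_le_iff.2 fun _ hi _ hj => monomial_mem_boxSpan (hi.trans_le h) hj

/-- Multiplication by `g` raises the degree in `x` by at most `c`. -/
def MulBound (K : Type*) {R : Type*} [Field K] [CommRing R] [Algebra K R] (x y : R) (e : ℕ)
    (g : R) (c : ℕ) : Prop :=
  ∀ d, ∀ h ∈ boxSpan K x y e d, g * h ∈ boxSpan K x y e (d + c)

theorem mulBound_of_monomial {g : R} {c : ℕ}
    (h : ∀ i, ∀ j < e, g * (x ^ i * y ^ j) ∈ boxSpan K x y e (i + 1 + c)) :
    MulBound K x y e g c := by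
  intro d
  suffices boxSpan K x y e d ≤ (boxSpan K x y e (d + c)).comap (LinearMap.mulLeft K g) from
    fun a ha => this ha
  exact boxSpan_le_iff.2 fun i hi j hj => boxSpan_mono (by omega) (h i j hj)

theorem MulBound.mono {g : R} {c c' : ℕ} (h : MulBound K x y e g c) (hc : c ≤ c') :
    MulBound K x y e g c' :=
  fun d a ha => boxSpan_mono (by omega) (h d a ha)

theorem MulBound.mul {g g' : R} {c c' : ℕ} (h : MulBound K x y e g c)
    (h' : MulBound K x y e g' c') : MulBound K x y e (g * g') (c + c') := by
  intro d a ha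
  rw [mul_assoc, add_comm c, ← add_assoc]
  exact h _ _ (h' _ _ ha)

theorem MulBound.pow {g : R} {c : ℕ} (h : MulBound K x y e g c) (n : ℕ) :
    MulBound K x y e (g ^ n) (n * c) := by
  induction n with
  | zero => intro d a ha; simpa using ha
  | succ n ih => rw [pow_succ, add_mul, one_mul]; exact ih.mul h

theorem MulBound.add {g g' : R} {c : ℕ} (h : MulBound K x y e g c)
    (h' : MulBound K x y e g' c) : MulBound K x y e (g + g') c := by
  intro d a ha
  rw [add_mul]
  exact add_mem (h _ _ ha) (h' _ _ ha)

theorem mulBound_x : MulBound K x y e x 1 :=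
  mulBound_of_monomial fun i j hj => by
    rw [← mul_assoc, ← pow_succ']
    exact monomial_mem_boxSpan (by omega) hj

theorem mulBound_aeval (p : K[X]) : MulBound K x y e (aeval x p) p.natDegree := by
  intro d b hb
  rw [aeval_eq_sum_range, Finset.sum_mul]
  refine sum_mem fun k hk => ?_
  rw [smul_mul_assoc]
  refine Submodule.smul_mem _ _ ?_
  have := (mulBound_x (K := K) (x := x) (y := y) (e := e)).pow k d b hb
  exact boxSpan_mono (by have := Finset.mem_range.1 hk; omega) this

theorem exists_mulBound_y {A : K[X][X]} (hA : A.Monic) (hdeg : A.natDegree = e)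
    (hAy : eval₂ (aeval x : K[X] →ₐ[K] R).toRingHom y A = 0) : ∃ κ, MulBound K x y e y κ := by
  let κ := ∑ s ∈ Finset.range e, (A.coeff s).natDegree
  have hye : y ^ e = -∑ s ∈ Finset.range e, aeval x (A.coeff s) * y ^ s := by
    rw [eval₂_eq_sum_range, Finset.sum_range_succ, hdeg] at hAy
    have h1 : A.coeff e = 1 := by rw [← hdeg]; exact hA
    rw [h1, map_one, one_mul] at hAy
    rw [eq_neg_iff_add_eq_zero, add_comm]
    exact hAy
  refine ⟨κ, mulBound_of_monomial fun i j hj => ?_⟩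
  rcases lt_or_eq_of_le (Nat.succ_le_of_lt hj) with h | h
  · have : y * (x ^ i * y ^ j) = x ^ i * y ^ (j + 1) := by ring
    rw [this]
    exact monomial_mem_boxSpan (by omega) h
  · have : y * (x ^ i * y ^ j) = -∑ s ∈ Finset.range e, aeval x (A.coeff s) * (x ^ i * y ^ s) := by
      calc y * (x ^ i * y ^ j) = x ^ i * y ^ (j + 1) := by ring
        _ = _ := by
          rw [← Nat.succ_eq_add_one, h, hye, mul_neg, Finset.mul_sum]
          congr 1
          exact Finset.sum_congr rfl fun s _ => by ring
    rw [this]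
    refine neg_mem (sum_mem fun s hs => ?_)
    refine boxSpan_mono ?_ (mulBound_aeval (A.coeff s) (i + 1) _
      (monomial_mem_boxSpan (Nat.lt_succ_self i) (Finset.mem_range.1 hs)))
    have := Finset.single_le_sum (f := fun s => (A.coeff s).natDegree)
      (fun _ _ => Nat.zero_le _) hs
    omega

end boxSpan

section Vanishing

variable {K R : Type*} [Field K] [CommRing R] [Algebra K R]

/-- Multiplication by `Y - y` followed by one step of division by `A`. -/
noncomputable def divStep (K : Type*) {R : Type*} [Field K] [CommRing R] [Algebra K R]
    (y : R) (e : ℕ) (A : R[X][X]) : R[X][X] →ₗ[K] R[X][X] where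
  toFun r := (X - C (C y)) * r - C (r.coeff (e - 1)) * A
  map_add' r s := by simp only [coeff_add, C_add]; ring
  map_smul' a r := by
    rw [coeff_smul, ← smul_C, mul_smul_comm, smul_mul_assoc, ← smul_sub, RingHom.id_apply]

theorem divStep_apply (y : R) (e : ℕ) (A r : R[X][X]) :
    divStep K y e A r = (X - C (C y)) * r - C (r.coeff (e - 1)) * A := rfl

/-- The quotient by `ξ` of the coefficients of `divStep`, dropping remainders. -/
noncomputable def divStepQuot (K : Type*) {R : Type*} [Field K] [CommRing R] [Algebra K R]
    (y : R) (e : ℕ) (A : R[X][X]) : R[X][X] →ₗ[K] R[X][X] where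
  toFun r := ∑ s ∈ Finset.range e, monomial s ((divStep K y e A r).coeff s).divX
  map_add' r s := by
    simp only [map_add, coeff_add, divX_add, ← Finset.sum_add_distrib]
  map_smul' a r := by
    simp only [map_smul, coeff_smul, RingHom.id_apply, Finset.smul_sum]
    refine Finset.sum_congr rfl fun s _ => ?_
    rw [smul_monomial]
    congr 1
    ext k
    simp only [coeff_divX, coeff_smul]

theorem divStepQuot_apply (y : R) (e : ℕ) (A r : R[X][X]) : divStepQuot K y e A r =
    ∑ s ∈ Finset.range e, monomial s ((divStep K y e A r).coeff s).divX := rfl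

/-- The constant term in `ξ` of a coefficient of `divStep`. -/
noncomputable def divStepRem (K : Type*) {R : Type*} [Field K] [CommRing R] [Algebra K R]
    (y : R) (e : ℕ) (A : R[X][X]) (s : ℕ) : R[X][X] →ₗ[K] R where
  toFun r := ((divStep K y e A r).coeff s).coeff 0
  map_add' r s := by simp only [map_add, coeff_add]
  map_smul' a r := by simp only [map_smul, coeff_smul, RingHom.id_apply]

variable {x y : R} {e : ℕ} {A : R[X][X]}

theorem coeff_divStepQuot (r : R[X][X]) (s : ℕ) : (divStepQuot K y e A r).coeff s =
    if s < e then ((divStep K y e A r).coeff s).divX else 0 := by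
  simp [divStepQuot_apply, coeff_monomial]

theorem coeff_divStep_of_le [Nontrivial R] (he : 0 < e) (hA : A.Monic) (hdeg : A.natDegree = e)
    {r : R[X][X]} (hr : ∀ s, e ≤ s → r.coeff s = 0) {s : ℕ} (hs : e ≤ s) :
    (divStep K y e A r).coeff s = 0 := by
  obtain ⟨s, rfl⟩ : ∃ t, s = t + 1 := ⟨s - 1, by omega⟩
  rw [divStep_apply, sub_mul, coeff_sub, coeff_sub, coeff_X_mul, coeff_C_mul, coeff_C_mul,
    hr _ hs, mul_zero, sub_zero]
  rcases eq_or_lt_of_le hs with h | h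
  · have : A.coeff (s + 1) = 1 := by rw [← h, ← hdeg]; exact hA
    rw [this, mul_one, show e - 1 = s by omega, sub_self]
  · rw [coeff_eq_zero_of_natDegree_lt (p := A) (by omega), hr _ (by omega), mul_zero, sub_zero]

theorem divStep_eq [Nontrivial R] (he : 0 < e) (hA : A.Monic) (hdeg : A.natDegree = e)
    (hAy : eval y (A.map constantCoeff) = 0)
    {r : R[X][X]} (hr : ∀ s, e ≤ s → r.coeff s = 0)
    (hrem : ∀ s, 1 ≤ s → s < e → divStepRem K y e A s r = 0) :
    divStep K y e A r = C X * divStepQuot K y e A r := by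
  have hroot : eval y ((divStep K y e A r).map constantCoeff) = 0 := by
    rw [divStep_apply, Polynomial.map_sub, Polynomial.map_mul, Polynomial.map_mul, eval_sub,
      eval_mul, eval_mul, hAy]
    simp
  have hconst : (divStep K y e A r).map constantCoeff =
      C (((divStep K y e A r).coeff 0).coeff 0) := by
    ext s
    rw [coeff_map, coeff_C]
    split_ifs with h
    · rw [h]; rfl
    · rcases lt_or_ge s e with hs | hs
      · exact hrem s (by omega) hs
      · rw [coeff_divStep_of_le he hA hdeg hr hs, map_zero]
  rw [hconst, eval_C] at hroot
  ext1 s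
  rw [coeff_C_mul, coeff_divStepQuot]
  split_ifs with hs
  · have h0 : ((divStep K y e A r).coeff s).coeff 0 = 0 := by
      rcases Nat.eq_zero_or_pos s with rfl | h
      · exact hroot
      · exact hrem s h hs
    have := X_mul_divX_add ((divStep K y e A r).coeff s)
    rw [h0, C_0, add_zero] at this
    exact this.symm
  · rw [coeff_divStep_of_le he hA hdeg hr (not_lt.1 hs), mul_zero]

theorem pow_mul_eq_of_divStepRem_eq_zero [Nontrivial R] (he : 0 < e) (hA : A.Monic)
    (hdeg : A.natDegree = e) (hAy : eval y (A.map constantCoeff) = 0)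
    {r : R[X][X]} (hr : ∀ s, e ≤ s → r.coeff s = 0) (m : ℕ)
    (hrem : ∀ i < m, ∀ s, 1 ≤ s → s < e →
      divStepRem K y e A s (((divStepQuot K y e A) ^ i) r) = 0) :
    ∃ t u : R[X][X], (X - C (C y)) ^ m * r = C X ^ m * t + A * u := by
  suffices ∃ u, (X - C (C y)) ^ m * r =
      C X ^ m * ((divStepQuot K y e A) ^ m) r + A * u from ⟨_, this⟩
  induction m with
  | zero => exact ⟨0, by simp⟩
  | succ m ih =>
    obtain ⟨u, hu⟩ := ih fun i hi => hrem i (by omega)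
    set t := ((divStepQuot K y e A) ^ m) r with ht
    have htdeg : ∀ s, e ≤ s → t.coeff s = 0 := by
      rcases m with _ | m
      · simpa [ht] using hr
      · intro s hs
        rw [ht, pow_succ', Module.End.mul_apply, coeff_divStepQuot, if_neg (not_lt.2 hs)]
    have h1 := divStep_eq (K := K) he hA hdeg hAy htdeg (hrem m (by omega))
    rw [divStep_apply] at h1
    refine ⟨C X ^ m * C (t.coeff (e - 1)) + (X - C (C y)) * u, ?_⟩
    rw [pow_succ', mul_assoc, hu, pow_succ' (divStepQuot K y e A), Module.End.mul_apply, ← ht]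
    linear_combination C X ^ m * h1

/-- All coefficients lie in `boxSpan K x y e d`. -/
def CoeffBound (K : Type*) {R : Type*} [Field K] [CommRing R] [Algebra K R] (x y : R) (e d : ℕ)
    (r : R[X][X]) : Prop :=
  ∀ s k, (r.coeff s).coeff k ∈ boxSpan K x y e d

theorem CoeffBound.divStep {d c : ℕ} {r : R[X][X]} (hr : CoeffBound K x y e d r)
    (hy : MulBound K x y e y c) (hA : ∀ s k, MulBound K x y e ((A.coeff s).coeff k) c) :
    CoeffBound K x y e (d + c) (divStep K y e A r) := by
  intro s k
  rw [divStep_apply, sub_mul]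
  simp only [coeff_sub, coeff_C_mul]
  rw [coeff_mul (r.coeff (e - 1))]
  refine sub_mem (sub_mem ?_ (hy _ _ (hr _ _))) (sum_mem fun p _ => ?_)
  · rcases s with _ | s
    · simp
    · rw [coeff_X_mul]; exact boxSpan_mono (by omega) (hr s k)
  · rw [mul_comm]; exact hA _ _ _ _ (hr _ _)

theorem CoeffBound.divStepQuot {d c : ℕ} {r : R[X][X]} (hr : CoeffBound K x y e d r)
    (hy : MulBound K x y e y c) (hA : ∀ s k, MulBound K x y e ((A.coeff s).coeff k) c) :
    CoeffBound K x y e (d + c) (divStepQuot K y e A r) := by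
  intro s k
  rw [coeff_divStepQuot]
  split_ifs
  · rw [coeff_divX]; exact hr.divStep hy hA _ _
  · simp

theorem CoeffBound.divStepQuot_pow {d c : ℕ} {r : R[X][X]} (hr : CoeffBound K x y e d r)
    (hy : MulBound K x y e y c) (hA : ∀ s k, MulBound K x y e ((A.coeff s).coeff k) c) (m : ℕ) :
    CoeffBound K x y e (d + m * c) (((_root_.divStepQuot K y e A) ^ m) r) := by
  induction m with
  | zero => simpa using hr
  | succ m ih =>
    rw [pow_succ', Module.End.mul_apply, add_mul, one_mul, ← add_assoc]
    exact ih.divStepQuot hy hA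

theorem exists_ne_zero_pow_mul_eq [Nontrivial R] {ι : Type*} [Fintype ι] (he : 0 < e)
    (hA : A.Monic) (hdeg : A.natDegree = e) (hAy : eval y (A.map constantCoeff) = 0)
    {c : ℕ} (hy : MulBound K x y e y c) (hAc : ∀ s k, MulBound K x y e ((A.coeff s).coeff k) c)
    {d m : ℕ} (ρ : (ι → K) →ₗ[K] R[X][X]) (hρ : ∀ v s, e ≤ s → (ρ v).coeff s = 0)
    (hρd : ∀ v, CoeffBound K x y e d (ρ v))
    (hcard : m * (e - 1) * ((d + m * c) * e) < Fintype.card ι) :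
    ∃ v : ι → K, v ≠ 0 ∧ ∃ t u : R[X][X], (X - C (C y)) ^ m * ρ v = C X ^ m * t + A * u := by
  let Φ : (ι → K) →ₗ[K] (Fin m × Fin (e - 1) → boxSpan K x y e (d + m * c)) :=
    LinearMap.pi fun p => LinearMap.codRestrict _
      (divStepRem K y e A (p.2 + 1) ∘ₗ ((divStepQuot K y e A) ^ (p.1 : ℕ)) ∘ₗ ρ) fun v => by
        have h := ((hρd v).divStepQuot_pow hy hAc p.1).divStep hy hAc (p.2 + 1) 0
        refine boxSpan_mono ?_ h
        have : ((p.1 : ℕ) + 1) * c ≤ m * c := Nat.mul_le_mul_right c p.1.2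
        rw [add_mul, one_mul] at this
        omega
  have hlt : Module.finrank K (Fin m × Fin (e - 1) → boxSpan K x y e (d + m * c)) <
      Module.finrank K (ι → K) := by
    rw [Module.finrank_pi_fintype, Module.finrank_pi]
    refine lt_of_le_of_lt ?_ hcard
    rw [Finset.sum_const, Finset.card_univ, Fintype.card_prod, Fintype.card_fin, Fintype.card_fin,
      smul_eq_mul]
    exact Nat.mul_le_mul_left _ (finrank_boxSpan_le _)
  obtain ⟨v, hv, hv0⟩ := (LinearMap.ker Φ).ne_bot_iff.1 (LinearMap.ker_ne_bot_of_finrank_lt hlt)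
  refine ⟨v, hv0, pow_mul_eq_of_divStepRem_eq_zero (K := K) he hA hdeg hAy (hρ v) m ?_⟩
  intro i hi s hs1 hs2
  have := congrArg Subtype.val (congrFun (LinearMap.mem_ker.1 hv) (⟨i, hi⟩, ⟨s - 1, by omega⟩))
  simpa [Φ, Nat.sub_add_cancel hs1] using this

end Vanishing

section AdjoinRoot

variable {K : Type*} [Field K] {A : K[X][X]}

theorem AdjoinRoot.algebraMap_eq_aeval (p : K[X]) :
    algebraMap K[X] (AdjoinRoot A) p = aeval (algebraMap K[X] (AdjoinRoot A) X) p := by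
  rw [aeval_algebraMap_apply, aeval_X_left_apply]

theorem AdjoinRoot.eval₂_aeval_root :
    eval₂ (aeval (algebraMap K[X] (AdjoinRoot A) X) : K[X] →ₐ[K] AdjoinRoot A).toRingHom
      (AdjoinRoot.root A) A = 0 := by
  have : (aeval (algebraMap K[X] (AdjoinRoot A) X) : K[X] →ₐ[K] AdjoinRoot A).toRingHom =
      AdjoinRoot.of A := by
    refine RingHom.ext fun p => ?_
    exact (AdjoinRoot.algebraMap_eq_aeval p).symm
  rw [this]
  exact AdjoinRoot.eval₂_root A

theorem AdjoinRoot.exists_mulBound (hA : A.Monic) (g : AdjoinRoot A) :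
    ∃ c, MulBound K (algebraMap K[X] (AdjoinRoot A) X) (AdjoinRoot.root A) A.natDegree g c := by
  obtain ⟨κ, hκ⟩ := exists_mulBound_y (K := K) hA rfl AdjoinRoot.eval₂_aeval_root
  induction g using AdjoinRoot.induction_on with
  | ih p =>
    induction p using Polynomial.induction_on' with
    | add p q hp hq =>
      obtain ⟨c, hc⟩ := hp
      obtain ⟨c', hc'⟩ := hq
      rw [map_add]
      exact ⟨max c c', (hc.mono (le_max_left _ _)).add (hc'.mono (le_max_right _ _))⟩
    | monomial n a =>
      refine ⟨a.natDegree + n * κ, ?_⟩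
      rw [← C_mul_X_pow_eq_monomial, map_mul, map_pow, AdjoinRoot.mk_X, AdjoinRoot.mk_C]
      have : AdjoinRoot.of A a = aeval (algebraMap K[X] (AdjoinRoot A) X) a :=
        AdjoinRoot.algebraMap_eq_aeval a
      rw [this]
      exact (mulBound_aeval a).mul (hκ.pow n)

theorem AdjoinRoot.exists_mulBound_coeff (hA : A.Monic) (B : (AdjoinRoot A)[X][X]) :
    ∃ c, ∀ s k, MulBound K (algebraMap K[X] (AdjoinRoot A) X) (AdjoinRoot.root A) A.natDegree
      ((B.coeff s).coeff k) c := by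
  choose c hc using AdjoinRoot.exists_mulBound hA
  refine ⟨B.support.sup fun s => (B.coeff s).support.sup fun k => c ((B.coeff s).coeff k),
    fun s k => ?_⟩
  by_cases h : (B.coeff s).coeff k = 0
  · rw [h]; intro d a _; rw [zero_mul]; exact zero_mem _
  · refine (hc _).mono ?_
    have hs : s ∈ B.support := by
      rw [mem_support_iff]; rintro h'; rw [h', coeff_zero] at h; exact h rfl
    refine le_trans ?_ (Finset.le_sup (f := fun s => (B.coeff s).support.sup
      fun k => c ((B.coeff s).coeff k)) hs)
    exact Finset.le_sup (f := fun k => c ((B.coeff s).coeff k)) (mem_support_iff.2 h)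

theorem AdjoinRoot.nontrivial_of_monic (hA : A.Monic) (he : 0 < A.natDegree) :
    Nontrivial (AdjoinRoot A) :=
  AdjoinRoot.nontrivial A (by
    rw [Ne, ← Nat.cast_zero, degree_eq_iff_natDegree_eq hA.ne_zero]
    omega)

theorem AdjoinRoot.linearIndependent_monomials (hA : A.Monic) (d : ℕ) :
    LinearIndependent K fun p : Fin d × Fin A.natDegree =>
      algebraMap K[X] (AdjoinRoot A) X ^ (p.1 : ℕ) * AdjoinRoot.root A ^ (p.2 : ℕ) := by
  let b : Module.Basis (Fin A.natDegree) K[X] (AdjoinRoot A) := (AdjoinRoot.powerBasis' hA).basis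
  have hb : ∀ j, b j = AdjoinRoot.root A ^ (j : ℕ) := fun j =>
    (AdjoinRoot.powerBasis' hA).basis_eq_pow j
  have h := ((Polynomial.basisMonomials K).smulTower b).linearIndependent.comp
    (fun p : Fin d × Fin A.natDegree => ((p.1 : ℕ), p.2)) (by
      rintro ⟨i, j⟩ ⟨i', j'⟩ h
      simp only [Prod.mk.injEq] at h
      exact Prod.ext (Fin.ext h.1) h.2)
  convert h using 1
  ext p
  simp only [Function.comp, Module.Basis.smulTower_apply, hb, coe_basisMonomials,
    monomial_one_right_eq_X_pow, Algebra.smul_def, map_pow]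

theorem AdjoinRoot.eq_zero_of_mem_boxSpan (hA : A.Monic) {g t : AdjoinRoot A} {p : K[X]} {d : ℕ}
    (hg : g ∈ boxSpan K (algebraMap K[X] (AdjoinRoot A) X) (AdjoinRoot.root A) A.natDegree d)
    (hgt : g = algebraMap K[X] (AdjoinRoot A) p * t) (hd : d ≤ p.natDegree) : g = 0 := by
  let b : Module.Basis (Fin A.natDegree) K[X] (AdjoinRoot A) := (AdjoinRoot.powerBasis' hA).basis
  have hb : ∀ j, b j = AdjoinRoot.root A ^ (j : ℕ) := fun j =>
    (AdjoinRoot.powerBasis' hA).basis_eq_pow j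
  have hdeg : ∀ s, b.repr g s ∈ degreeLT K d := by
    intro s
    let S : Submodule K (AdjoinRoot A) :=
      (degreeLT K d).comap ((b.coord s).restrictScalars K)
    suffices boxSpan K (algebraMap K[X] (AdjoinRoot A) X) (AdjoinRoot.root A) A.natDegree d ≤ S from
      this hg
    refine boxSpan_le_iff.2 fun i hi j hj => ?_
    have : algebraMap K[X] (AdjoinRoot A) X ^ i * AdjoinRoot.root A ^ j =
        (X ^ i : K[X]) • b ⟨j, hj⟩ := by
      rw [hb, Algebra.smul_def, map_pow]
    rw [Submodule.mem_comap, this, LinearMap.coe_restrictScalars, map_smul, b.coord_apply,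
      b.repr_self, mem_degreeLT, Finsupp.single_apply]
    split_ifs
    · simpa using hi
    · simp
  refine b.repr.map_eq_zero_iff.1 (Finsupp.ext fun s => ?_)
  have hs : b.repr g s = p * b.repr t s := by
    rw [hgt, ← Algebra.smul_def, map_smul]; rfl
  by_contra hne
  have h1 := mem_degreeLT.1 (hdeg s)
  have hp : p ≠ 0 := by rintro rfl; rw [zero_mul] at hs; exact hne hs
  have ht : b.repr t s ≠ 0 := by intro h; rw [h, mul_zero] at hs; exact hne hs
  rw [hs, degree_eq_natDegree (mul_ne_zero hp ht), natDegree_mul hp ht] at h1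
  have : p.natDegree + (b.repr t s).natDegree < d := by exact_mod_cast h1
  omega

theorem AdjoinRoot.exists_auxiliary [Fintype K] (hA : A.Monic) (he : 0 < A.natDegree) (m : ℕ) :
    ∃ c, ∀ I U : ℕ, m * (A.natDegree - 1) * ((U + I + c) * A.natDegree) <
      U * A.natDegree * (I * A.natDegree) →
    ∃ v : (Fin U × Fin A.natDegree) → (Fin I × Fin A.natDegree) → K, v ≠ 0 ∧ ∀ r : ℕ,
      ∃ t : AdjoinRoot A,
        (AdjoinRoot.root A - AdjoinRoot.root A ^ Fintype.card K ^ r) ^ m * ∑ a, ∑ b, v a b •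
          ((algebraMap K[X] (AdjoinRoot A) X ^ (a.1 : ℕ) * AdjoinRoot.root A ^ (a.2 : ℕ)) *
          (algebraMap K[X] (AdjoinRoot A) X ^ (b.1 : ℕ) * AdjoinRoot.root A ^ (b.2 : ℕ)) ^
            Fintype.card K ^ r) =
        (algebraMap K[X] (AdjoinRoot A) X -
          algebraMap K[X] (AdjoinRoot A) X ^ Fintype.card K ^ r) ^ m * t := by
  have : Nontrivial (AdjoinRoot A) := AdjoinRoot.nontrivial_of_monic hA he
  set x := algebraMap K[X] (AdjoinRoot A) X with hx
  set y := AdjoinRoot.root A with hy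
  set e := A.natDegree with hedef
  let φ : K[X] →ₐ[K] (AdjoinRoot A)[X] := aeval (X + C x)
  let B : (AdjoinRoot A)[X][X] := A.map φ.toRingHom
  have hB : B.Monic := hA.map _
  have hBdeg : B.natDegree = e := hA.natDegree_map _
  have hBy : eval y (B.map constantCoeff) = 0 := by
    have h : constantCoeff.comp φ.toRingHom =
        (aeval x : K[X] →ₐ[K] AdjoinRoot A).toRingHom := by
      ext <;> simp [φ]
    rw [Polynomial.map_map, h, eval_map]
    exact AdjoinRoot.eval₂_aeval_root
  obtain ⟨c₁, hc₁⟩ := AdjoinRoot.exists_mulBound hA y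
  obtain ⟨c₂, hc₂⟩ := AdjoinRoot.exists_mulBound_coeff hA B
  refine ⟨m * max c₁ c₂, fun I U hIU => ?_⟩
  let b : (Fin U × Fin e) × (Fin I × Fin e) → (AdjoinRoot A)[X][X] := fun p =>
    C ((X + C x) ^ (p.1.1 : ℕ) * C (x ^ (p.2.1 : ℕ) * y ^ (p.2.2 : ℕ))) * X ^ (p.1.2 : ℕ)
  let ρ : ((Fin U × Fin e) × (Fin I × Fin e) → K) →ₗ[K] (AdjoinRoot A)[X][X] :=
    Fintype.linearCombination K b
  have hbcoeff : ∀ p s, (b p).coeff s = if s = p.1.2 then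
      (X + C x) ^ (p.1.1 : ℕ) * C (x ^ (p.2.1 : ℕ) * y ^ (p.2.2 : ℕ)) else 0 := fun p s => by
    simp only [b, coeff_C_mul, coeff_X_pow, mul_ite, mul_one, mul_zero]
  have hρ : ∀ v s, e ≤ s → (ρ v).coeff s = 0 := by
    intro v s hs
    rw [Fintype.linearCombination_apply, finsetSum_coeff]
    refine Finset.sum_eq_zero fun p _ => ?_
    rw [coeff_smul, hbcoeff, if_neg (by have := p.1.2.2; omega), smul_zero]
  have hρd : ∀ v, CoeffBound K x y e (U + I) (ρ v) := by
    intro v s k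
    rw [Fintype.linearCombination_apply, finsetSum_coeff, finsetSum_coeff]
    refine sum_mem fun p _ => ?_
    rw [coeff_smul, coeff_smul, hbcoeff]
    refine Submodule.smul_mem _ _ ?_
    split_ifs
    · rw [coeff_mul_C, coeff_X_add_C_pow]
      have : x ^ ((p.1.1 : ℕ) - k) * ((p.1.1 : ℕ).choose k : AdjoinRoot A) *
          (x ^ (p.2.1 : ℕ) * y ^ (p.2.2 : ℕ)) = (p.1.1 : ℕ).choose k •
          (x ^ ((p.1.1 : ℕ) - k + p.2.1) * y ^ (p.2.2 : ℕ)) := by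
        rw [nsmul_eq_mul]; ring
      rw [this]
      exact nsmul_mem (monomial_mem_boxSpan (by omega) p.2.2.2) _
    · rw [coeff_zero]; exact zero_mem _
  obtain ⟨v, hv0, t, u, htu⟩ := exists_ne_zero_pow_mul_eq he hB hBdeg hBy
    (hc₁.mono (le_max_left c₁ c₂)) (fun s k => (hc₂ s k).mono (le_max_right c₁ c₂))
    (d := U + I) (m := m) ρ hρ hρd (by simpa using hIU)
  refine ⟨fun a b => v (a, b), fun h => hv0 (funext fun p => congrFun (congrFun h p.1) p.2),
    fun r => ?_⟩
  set q := Fintype.card K with hq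
  obtain ⟨p, hp⟩ := CharP.exists K
  obtain ⟨n, hpp, hqn⟩ := FiniteField.card K p
  have : Fact p.Prime := ⟨hpp⟩
  have : CharP (AdjoinRoot A) p := charP_of_injective_algebraMap (algebraMap K _).injective p
  have hQp : q ^ r = p ^ (n * r : ℕ) := by rw [hq, hqn, pow_mul]
  let F : AdjoinRoot A →+* AdjoinRoot A := iterateFrobenius (AdjoinRoot A) p (n * r)
  have hF : ∀ g, F g = g ^ q ^ r := fun g => by rw [hQp]; rfl
  have hFK : ∀ a : K, F (algebraMap K _ a) = algebraMap K _ a := fun a => by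
    rw [hF, ← map_pow, hq, FiniteField.pow_card_pow]
  let Ψ : (AdjoinRoot A)[X][X] →+* AdjoinRoot A :=
    eval₂RingHom (eval₂RingHom F (x - x ^ q ^ r)) y
  have hΨX : Ψ X = y := by simp [Ψ]
  have hΨC : ∀ g, Ψ (C (C g)) = g ^ q ^ r := fun g => by simp [Ψ, hF]
  have hΨξ : Ψ (C X) = x - x ^ q ^ r := by simp [Ψ]
  have hΨB : Ψ B = 0 := by
    have h : (eval₂RingHom F (x - x ^ q ^ r)).comp φ.toRingHom =
        (aeval x : K[X] →ₐ[K] AdjoinRoot A).toRingHom := by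
      refine Polynomial.ringHom_ext (fun a => ?_) ?_
      · simp only [φ, RingHom.comp_apply, AlgHom.toRingHom_eq_coe, RingHom.coe_coe, aeval_C]
        exact (eval₂_C _ _).trans (hFK a)
      · simp [φ, hF]
    have : Ψ B = eval₂ ((eval₂RingHom F (x - x ^ q ^ r)).comp φ.toRingHom) y A := by
      simp only [Ψ, B, coe_eval₂RingHom, eval₂_map]
    rw [this, h]
    exact AdjoinRoot.eval₂_aeval_root
  have h := congrArg Ψ htu
  rw [map_mul, map_pow, map_sub, hΨX, hΨC, map_add, map_mul, map_mul, hΨB, zero_mul, add_zero,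
    map_pow, hΨξ] at h
  refine ⟨Ψ t, ?_⟩
  rw [← h]
  congr 1
  have hρv : ρ v = ∑ a, ∑ b', v (a, b') • b (a, b') := by
    rw [Fintype.linearCombination_apply, Fintype.sum_prod_type]
  simp only [hρv, map_sum]
  refine Finset.sum_congr rfl fun a _ => ?_
  refine Finset.sum_congr rfl fun b' _ => ?_
  have hs : ∀ (a : K) (g : (AdjoinRoot A)[X][X]), Ψ (a • g) = a • Ψ g := fun a g => by
    rw [Algebra.smul_def, map_mul, Algebra.smul_def]
    congr 1
    have : algebraMap K (AdjoinRoot A)[X][X] a = C (C (algebraMap K _ a)) := rfl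
    rw [this, hΨC, ← hF, hFK]
  rw [hs]
  congr 1
  simp only [b, map_mul, map_pow, map_add, hΨX, hΨC, hΨξ]
  ring

end AdjoinRoot

theorem pow_dvd_pow_mul_of_pow_dvd {R : Type*} [CommRing R] {d ξ w α g : R} {m : ℕ}
    (hd : d = α * ξ + w) (h : ξ ^ m ∣ w ^ m * g) : ξ ^ m ∣ d ^ (m * m) * g := by
  have h1 : w ∣ d ^ m - (α * ξ) ^ m := by
    have := sub_dvd_pow_sub_pow d (α * ξ) m
    rwa [show d - α * ξ = w by rw [hd, add_sub_cancel_left]] at this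
  have h2 : ξ ^ m ∣ d ^ (m * m) - (d ^ m - (α * ξ) ^ m) ^ m := by
    have := sub_dvd_pow_sub_pow (d ^ m) (d ^ m - (α * ξ) ^ m) m
    rw [sub_sub_cancel, ← pow_mul] at this
    exact (pow_dvd_pow_of_dvd (dvd_mul_left ξ α) m).trans this
  have h3 : ξ ^ m ∣ (d ^ m - (α * ξ) ^ m) ^ m * g :=
    h.trans (mul_dvd_mul_right (pow_dvd_pow_of_dvd h1 m) g)
  have := dvd_add (h2.mul_right g) h3
  rwa [← add_mul, sub_add_cancel] at this

theorem AdjoinRoot.exists_notMem_span {K E : Type*} [Field K] [Fintype K] [Field E] [Algebra K E]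
    (v : AddValuation E (WithTop ℚ)) (hv : ∀ t, 0 ≤ v t → ∃ c : K, 0 < v (t - algebraMap K E c))
    {A : K[X][X]} (hA : A.Monic) (he : 0 < A.natDegree) (θ : AdjoinRoot A →ₐ[K] E)
    (hθ : Function.Injective θ) {d : K[X]} (hd : d ≠ 0) :
    ∃ r₀, ∀ r ≥ r₀, algebraMap K[X] (AdjoinRoot A) d ∉ Ideal.span
      {algebraMap K[X] (AdjoinRoot A) X - algebraMap K[X] (AdjoinRoot A) X ^ Fintype.card K ^ r,
        AdjoinRoot.root A - AdjoinRoot.root A ^ Fintype.card K ^ r} := by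
  set x := algebraMap K[X] (AdjoinRoot A) X with hx
  set y := AdjoinRoot.root A with hy
  obtain ⟨κ, hκ⟩ := exists_mulBound_y (K := K) hA rfl AdjoinRoot.eval₂_aeval_root
  rw [← hx, ← hy] at hκ
  obtain ⟨e, hedef⟩ : ∃ e, A.natDegree = e + 1 := ⟨A.natDegree - 1, by omega⟩
  set M := 2 + e * κ with hM
  set m := (e + 1) * M with hm
  set I := M * e + 1 with hI
  obtain ⟨c, hc⟩ := AdjoinRoot.exists_auxiliary hA he m
  set U := M * e * (I + c) + 1 with hU
  obtain ⟨u, hu0, hu⟩ := hc I U (by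
    rw [hedef, Nat.add_sub_cancel, hm]
    have : M * e * (U + I + c) < U * I := by
      have h1 : M * e * (I + c) < U := Nat.lt_succ_self _
      calc M * e * (U + I + c) = M * e * U + M * e * (I + c) := by ring
        _ < M * e * U + U := by omega
        _ = U * I := by rw [hI]; ring
    calc (e + 1) * M * e * ((U + I + c) * (e + 1))
          = (M * e * (U + I + c)) * ((e + 1) * (e + 1)) := by
          ring
      _ < (U * I) * ((e + 1) * (e + 1)) := Nat.mul_lt_mul_of_pos_right this (by positivity)
      _ = _ := by ring)
  have hw : LinearIndependent K fun a : Fin U × Fin A.natDegree =>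
      θ (x ^ (a.1 : ℕ) * y ^ (a.2 : ℕ)) :=
    (AdjoinRoot.linearIndependent_monomials hA U).map' θ.toLinearMap
      (LinearMap.ker_eq_bot.2 hθ)
  have hg : LinearIndependent K fun a : Fin I × Fin A.natDegree =>
      θ (x ^ (a.1 : ℕ) * y ^ (a.2 : ℕ)) :=
    (AdjoinRoot.linearIndependent_monomials hA I).map' θ.toLinearMap
      (LinearMap.ker_eq_bot.2 hθ)
  obtain ⟨r₀, hr₀⟩ := linearIndependent_mul_pow_card_pow v hv hw hg
  refine ⟨max r₀ (1 + U + e * κ + m * m * d.natDegree), fun r hr hmem => ?_⟩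
  set Q := Fintype.card K ^ r with hQ
  have hq : 1 < Fintype.card K := Fintype.one_lt_card
  have hQr : r < Q := Nat.lt_pow_self hq
  have hQb : 1 + U + e * κ + m * m * d.natDegree ≤ Q := by
    have := (le_max_right r₀ _).trans hr
    omega
  obtain ⟨α, β, hαβ⟩ := Ideal.mem_span_pair.1 hmem
  obtain ⟨t, ht⟩ := hu r
  set g := ∑ a : Fin U × Fin A.natDegree, ∑ b : Fin I × Fin A.natDegree, u a b •
    ((x ^ (a.1 : ℕ) * y ^ (a.2 : ℕ)) * (x ^ (b.1 : ℕ) * y ^ (b.2 : ℕ)) ^ Q) with hgdef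
  obtain ⟨t', ht'⟩ : (x - x ^ Q) ^ m ∣ algebraMap K[X] (AdjoinRoot A) d ^ (m * m) * g := by
    refine pow_dvd_pow_mul_of_pow_dvd hαβ.symm ?_
    rw [mul_pow, mul_assoc, ht]
    exact (dvd_mul_right _ _).mul_left _
  have hgbox : g ∈ boxSpan K x y A.natDegree (1 + U + Q * I + e * (1 + Q) * κ) := by
    refine sum_mem fun a _ => sum_mem fun b _ => Submodule.smul_mem _ _ ?_
    have h1 : (1 : AdjoinRoot A) ∈ boxSpan K x y A.natDegree 1 := by
      simpa using monomial_mem_boxSpan (K := K) (x := x) (y := y) (i := 0) (j := 0) one_pos he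
    have h2 := ((mulBound_x (K := K) (x := x) (y := y) (e := A.natDegree)).pow a.1).mul
      (hκ.pow a.2) |>.mul ((((mulBound_x (K := K) (x := x) (y := y) (e := A.natDegree)).pow
        b.1).mul (hκ.pow b.2)).pow Q) 1 1 h1
    rw [mul_one (_ * _ : AdjoinRoot A)] at h2
    refine boxSpan_mono ?_ h2
    have ha1 := a.1.2
    have ha2 : (a.2 : ℕ) * κ ≤ e * κ := Nat.mul_le_mul_right _ (by have := a.2.2; omega)
    have hb1 : Q * (b.1 : ℕ) ≤ Q * I := Nat.mul_le_mul_left _ b.1.2.le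
    have hb2 : Q * ((b.2 : ℕ) * κ) ≤ Q * (e * κ) :=
      Nat.mul_le_mul_left _ (Nat.mul_le_mul_right _ (by have := b.2.2; omega))
    calc 1 + ((a.1 : ℕ) * 1 + a.2 * κ + Q * (b.1 * 1 + b.2 * κ))
        = 1 + a.1 + a.2 * κ + Q * b.1 + Q * (b.2 * κ) := by ring
      _ ≤ 1 + U + e * κ + Q * I + Q * (e * κ) := by omega
      _ = _ := by ring
  have hdbound : MulBound K x y A.natDegree (algebraMap K[X] (AdjoinRoot A) d) d.natDegree := by
    rw [AdjoinRoot.algebraMap_eq_aeval]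
    exact mulBound_aeval d
  have hzero : algebraMap K[X] (AdjoinRoot A) d ^ (m * m) * g = 0 := by
    refine AdjoinRoot.eq_zero_of_mem_boxSpan hA (p := (X - X ^ Q) ^ m) (t := t')
      (hdbound.pow (m * m) _ _ hgbox) ?_ ?_
    · rw [ht', map_pow, map_sub, map_pow]
    · have hdeg : (X - X ^ Q : K[X]).natDegree = Q := by
        rw [← neg_sub, natDegree_neg]
        exact FiniteField.X_pow_card_sub_X_natDegree_eq K (by omega)
      rw [natDegree_pow, hdeg]
      calc 1 + U + Q * I + e * (1 + Q) * κ + m * m * d.natDegree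
          = (1 + U + e * κ + m * m * d.natDegree) + Q * I + Q * e * κ := by ring
        _ ≤ Q + Q * I + Q * e * κ := by omega
        _ = m * Q := by rw [hm, hI, hM]; ring
  have hθd : θ (algebraMap K[X] (AdjoinRoot A) d) ≠ 0 := by
    rw [Ne, map_eq_zero_iff θ hθ]
    refine (map_ne_zero_iff _ (AdjoinRoot.of.injective_of_degree_ne_zero ?_)).2 hd
    exact (natDegree_pos_iff_degree_pos.1 he).ne'
  have hθg : θ g = 0 := by
    have := congrArg θ hzero
    rw [map_mul, map_pow, map_zero] at this
    exact (mul_eq_zero.1 this).resolve_left (pow_ne_zero _ hθd)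
  refine hu0 (funext fun a => funext fun b => hr₀ r ((le_max_left _ _).trans hr) u ?_ a b)
  rw [← hθg, hgdef]
  simp only [map_sum, map_smul, map_mul, map_pow]
  rfl

theorem exists_algHom_apply_ne_zero {K L R : Type*} [Field K] [Field L] [Fintype L] [Algebra K L]
    [CommRing R] [Algebra K R] {x y d : R} (hxy : Algebra.adjoin K {x, y} = ⊤)
    (hd : d ∉ Ideal.span {x - x ^ Fintype.card L, y - y ^ Fintype.card L}) :
    ∃ ψ : R →ₐ[K] L, ψ d ≠ 0 := by
  set Q := Fintype.card L with hQ
  set J : Ideal R := Ideal.span {x - x ^ Q, y - y ^ Q} with hJ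
  have hd0 : Ideal.Quotient.mk J d ≠ 0 := by rwa [Ne, Ideal.Quotient.eq_zero_iff_mem]
  have : Nontrivial (R ⧸ J) := ⟨_, _, hd0⟩
  obtain ⟨p, _⟩ := CharP.exists L
  obtain ⟨n, hp, hcard⟩ := FiniteField.card L p
  have : Fact p.Prime := ⟨hp⟩
  have : CharP K p := (algebraMap K L).charP (algebraMap K L).injective p
  have : CharP (R ⧸ J) p := charP_of_injective_algebraMap (algebraMap K (R ⧸ J)).injective p
  have hpow : ∀ t : R ⧸ J, t ^ Q = t := by
    intro t
    have hF : ∀ s : R ⧸ J, s ^ Q = iterateFrobenius (R ⧸ J) p n s := fun s => by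
      rw [hQ, hcard]; rfl
    obtain ⟨t, rfl⟩ := Ideal.Quotient.mk_surjective t
    have ht : t ∈ Algebra.adjoin K {x, y} := hxy ▸ Algebra.mem_top
    rw [hF]
    induction ht using Algebra.adjoin_induction with
    | mem s hs =>
      rw [← hF, ← map_pow, eq_comm, Ideal.Quotient.eq]
      rcases hs with rfl | rfl
      · exact Ideal.subset_span (Set.mem_insert _ _)
      · exact Ideal.subset_span (Set.mem_insert_of_mem _ rfl)
    | algebraMap c =>
      have hc : c ^ Q = c := by
        apply (algebraMap K L).injective
        rw [map_pow, hQ, FiniteField.pow_card]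
      rw [← hF, ← map_pow, ← map_pow, hc]
    | add a b _ _ ha hb => rw [map_add, map_add, ha, hb]
    | mul a b _ _ ha hb => rw [map_mul, map_mul, ha, hb]
  have hnil : ¬ IsNilpotent (Ideal.Quotient.mk J d) := by
    rintro ⟨k, hk⟩
    have h1 : ∀ k, (Ideal.Quotient.mk J d) ^ Q ^ k = Ideal.Quotient.mk J d := by
      intro k
      induction k with
      | zero => simp
      | succ k ih => rw [pow_succ, pow_mul, ih, hpow]
    exact hd0 (h1 k ▸ pow_eq_zero_of_le (Nat.lt_pow_self Fintype.one_lt_card).le hk)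
  obtain ⟨P, hP, hdP⟩ : ∃ P : Ideal (R ⧸ J), P.IsPrime ∧ Ideal.Quotient.mk J d ∉ P := by
    by_contra! h
    exact hnil (nilpotent_iff_mem_prime.2 h)
  have h_int : Algebra.IsIntegral K ((R ⧸ J) ⧸ P) := by
    refine ⟨fun t => ⟨X ^ Q - X, ?_, ?_⟩⟩
    · exact monic_X_pow_sub (by
        rw [degree_X]; exact_mod_cast (Fintype.one_lt_card (α := L)))
    · obtain ⟨t, rfl⟩ := Ideal.Quotient.mk_surjective t
      simp [← map_pow, hpow]
  let φ : ((R ⧸ J) ⧸ P) →ₐ[K] AlgebraicClosure L := IsAlgClosed.lift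
  let π : R →ₐ[K] ((R ⧸ J) ⧸ P) := (Ideal.Quotient.mkₐ K P).comp (Ideal.Quotient.mkₐ K J)
  have hmem : ∀ t, (φ.comp π) t ∈ (IsScalarTower.toAlgHom K L (AlgebraicClosure L)).range := by
    intro t
    have h1 : (φ.comp π t) ^ Q = φ.comp π t := by
      have : π t ^ Q = π t := by
        have := congrArg (Ideal.Quotient.mk P) (hpow (Ideal.Quotient.mk J t))
        rwa [map_pow] at this
      rw [AlgHom.comp_apply, ← map_pow, this]
    have h2 : eval₂ (algebraMap L (AlgebraicClosure L)) (φ.comp π t) (X ^ Q - X) = 0 := by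
      rw [eval₂_sub, eval₂_X_pow, eval₂_X, h1, sub_self]
    have hs : (X ^ Q - X : L[X]).Splits := by
      simpa using (FiniteField.isSplittingField_sub L L).splits
    obtain ⟨a, ha⟩ := hs.mem_range_of_isRoot
      (FiniteField.X_pow_card_sub_X_ne_zero L Fintype.one_lt_card) ((eval_map _ _).trans h2)
    exact ⟨a, ha⟩
  have hφd : φ (π d) ≠ 0 := by
    have h0 : π d ≠ 0 := fun h => hdP (Ideal.Quotient.eq_zero_iff_mem.1 h)
    have h1 : π d ^ Q = π d := by
      have := congrArg (Ideal.Quotient.mk P) (hpow (Ideal.Quotient.mk J d))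
      rwa [map_pow] at this
    have h2 : π d ^ (Q - 1) = 1 := by
      refine mul_left_cancel₀ h0 ?_
      rw [← pow_succ', Nat.sub_add_cancel Fintype.card_pos, h1, mul_one]
    intro h
    have h3 := congrArg φ h2
    rw [map_pow, h, map_one, zero_pow (Nat.sub_ne_zero_of_lt Fintype.one_lt_card)] at h3
    exact zero_ne_one h3
  let ε := AlgEquiv.ofInjective (IsScalarTower.toAlgHom K L (AlgebraicClosure L))
    (algebraMap L (AlgebraicClosure L)).injective
  refine ⟨(ε.symm : _ →ₐ[K] L).comp ((φ.comp π).codRestrict _ hmem), ?_⟩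
  intro h
  have h1 : ε.symm ((φ.comp π).codRestrict _ hmem d) = 0 := h
  rw [map_eq_zero_iff _ ε.symm.injective] at h1
  exact hφd (congrArg Subtype.val h1)

theorem AdjoinRoot.adjoin_X_root_eq_top {K : Type*} [Field K] (A : K[X][X]) :
    Algebra.adjoin K {algebraMap K[X] (AdjoinRoot A) X, AdjoinRoot.root A} = ⊤ := by
  refine eq_top_iff.2 fun t _ => ?_
  set S := Algebra.adjoin K {algebraMap K[X] (AdjoinRoot A) X, AdjoinRoot.root A} with hS
  have hx : algebraMap K[X] (AdjoinRoot A) X ∈ S :=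
    Algebra.subset_adjoin (Set.mem_insert _ _)
  have hy : AdjoinRoot.root A ∈ S :=
    Algebra.subset_adjoin (Set.mem_insert_of_mem _ rfl)
  have hp : ∀ p : K[X], AdjoinRoot.of A p ∈ S := fun p => by
    have : AdjoinRoot.of A p = aeval (algebraMap K[X] (AdjoinRoot A) X) p :=
      AdjoinRoot.algebraMap_eq_aeval p
    rw [this]
    exact Algebra.adjoin_mono (Set.singleton_subset_iff.2 (Set.mem_insert _ _))
      (aeval_mem_adjoin_singleton K _)
  induction t using AdjoinRoot.induction_on with
  | ih p =>
    induction p using Polynomial.induction_on' with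
    | add p q hp hq => rw [map_add]; exact add_mem (hp trivial) (hq trivial)
    | monomial n a =>
      rw [← C_mul_X_pow_eq_monomial, map_mul, map_pow, AdjoinRoot.mk_X, AdjoinRoot.mk_C]
      exact mul_mem (hp a) (pow_mem hy n)

/-- A nonzero solution of `G (x, y) = 0` in a valued field with finite residue field `K` yields
solutions with nonzero coordinates in all sufficiently large finite extensions of `K`. -/
theorem exists_root_finite_extension {K E : Type*} [Field K] [Fintype K] [Field E] [Algebra K E]
    (v : AddValuation E (WithTop ℚ)) (hv : ∀ t, 0 ≤ v t → ∃ c : K, 0 < v (t - algebraMap K E c))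
    {x y : E} (hx : Transcendental K x) (hy : y ≠ 0) {G : K[X][X]} (hG : G ≠ 0)
    (hGy : eval₂ (aeval x : K[X] →ₐ[K] E).toRingHom y G = 0) :
    ∃ r₀, ∀ (L : Type) [Field L] [Fintype L] [Algebra K L], r₀ ≤ Module.finrank K L →
      ∃ a b : L, a ≠ 0 ∧ b ≠ 0 ∧ eval₂ (aeval a : K[X] →ₐ[K] L).toRingHom b G = 0 := by
  let : Algebra K[X] E := (aeval x : K[X] →ₐ[K] E).toRingHom.toAlgebra
  have halg : ∀ p : K[X], algebraMap K[X] E p = aeval x p := fun _ => rfl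
  have : IsScalarTower K K[X] E := IsScalarTower.of_algebraMap_eq fun c => by
    rw [halg, algebraMap_eq, aeval_C]
  have hinj : Function.Injective (algebraMap K[X] E) := transcendental_iff_injective.1 hx
  have : FaithfulSMul K[X] E := (faithfulSMul_iff_algebraMap_injective _ _).2 hinj
  have hyalg : IsAlgebraic K[X] y := ⟨G, hG, hGy⟩
  obtain ⟨a, ha0, h_int⟩ := hyalg.exists_integral_multiple
  rw [Algebra.smul_def] at h_int
  set y₁ := algebraMap K[X] E a * y with hy₁
  have ha1 : algebraMap K[X] E a ≠ 0 := (map_ne_zero_iff _ hinj).2 ha0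
  have hy₁0 : y₁ ≠ 0 := mul_ne_zero ha1 hy
  set A := minpoly K[X] y₁ with hA
  have hmonic : A.Monic := minpoly.monic h_int
  have hdeg : 0 < A.natDegree := minpoly.natDegree_pos h_int
  have hA0 : A.coeff 0 ≠ 0 := by
    intro h
    have h1 := X_mul_divX_add A
    rw [h, C_0, add_zero] at h1
    have h2 : aeval y₁ A.divX = 0 := by
      have := minpoly.aeval K[X] y₁
      rw [← hA, ← h1, map_mul, aeval_X] at this
      exact (mul_eq_zero.1 this).resolve_left hy₁0
    have h3 : A.divX ≠ 0 := by
      intro h3; rw [h3, mul_zero] at h1; exact hmonic.ne_zero h1.symm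
    have h4 := natDegree_le_of_dvd (minpoly.isIntegrallyClosed_dvd h_int h2) h3
    rw [natDegree_divX_eq_natDegree_tsub_one, ← hA] at h4
    omega
  let θ : AdjoinRoot A →ₐ[K[X]] E :=
    AdjoinRoot.liftAlgHom A (Algebra.ofId K[X] E) y₁ (minpoly.aeval K[X] y₁)
  have hθmk : ∀ p, θ (AdjoinRoot.mk A p) = aeval y₁ p := fun _ => rfl
  have hθ : Function.Injective θ := by
    rw [injective_iff_map_eq_zero]
    intro t ht
    induction t using AdjoinRoot.induction_on with
    | ih p =>
      rw [hθmk] at ht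
      exact AdjoinRoot.mk_eq_zero.2 (minpoly.isIntegrallyClosed_dvd h_int ht)
  obtain ⟨r₀, hr₀⟩ := AdjoinRoot.exists_notMem_span v hv hmonic hdeg (θ.restrictScalars K) hθ
    (mul_ne_zero (mul_ne_zero X_ne_zero ha0) hA0)
  refine ⟨r₀, fun L _ _ _ hL => ?_⟩
  obtain ⟨ψ, hψ⟩ := exists_algHom_apply_ne_zero (L := L) (AdjoinRoot.adjoin_X_root_eq_top A)
    (by rw [Module.card_eq_pow_finrank (K := K) (V := L)]; exact hr₀ _ hL)
  set x₀ := ψ (algebraMap K[X] (AdjoinRoot A) X) with hx₀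
  have hψp : ∀ p : K[X], ψ (AdjoinRoot.of A p) = aeval x₀ p := fun p => by
    rw [hx₀, aeval_algHom_apply, ← AdjoinRoot.algebraMap_eq_aeval]; rfl
  have hψmk : ∀ p, ψ (AdjoinRoot.mk A p) =
      eval₂ (aeval x₀ : K[X] →ₐ[K] L).toRingHom (ψ (AdjoinRoot.root A)) p := fun p => by
    induction p using Polynomial.induction_on' with
    | add p q hp hq => rw [map_add, map_add, hp, hq, eval₂_add]
    | monomial n a =>
      rw [← C_mul_X_pow_eq_monomial, map_mul, map_pow, AdjoinRoot.mk_X, AdjoinRoot.mk_C, map_mul,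
        map_pow, hψp, eval₂_mul, eval₂_X_pow, eval₂_C]
      rfl
  rw [map_mul, map_mul, map_mul, map_mul] at hψ
  have hψa : aeval x₀ a ≠ 0 := by
    rw [← hψp]; exact right_ne_zero_of_mul (left_ne_zero_of_mul hψ)
  have hψy : ψ (AdjoinRoot.root A) ≠ 0 := by
    intro h
    refine right_ne_zero_of_mul hψ ?_
    have h1 := congrArg (fun p => ψ (AdjoinRoot.mk A p)) (X_mul_divX_add A)
    simp only [AdjoinRoot.mk_self, map_add, map_mul, AdjoinRoot.mk_X, h, zero_mul, zero_add,
      map_zero, AdjoinRoot.mk_C] at h1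
    exact h1
  refine ⟨x₀, ψ (AdjoinRoot.root A) / aeval x₀ a, left_ne_zero_of_mul (left_ne_zero_of_mul hψ),
    div_ne_zero hψy hψa, ?_⟩
  have hs : AdjoinRoot.mk A (scaleRoots G a) = 0 := by
    rw [← map_eq_zero_iff θ hθ, hθmk, aeval_def, hy₁, scaleRoots_eval₂_mul]
    exact mul_eq_zero_of_right _ hGy
  have h2 := hψmk (scaleRoots G a)
  rw [hs, map_zero] at h2
  have h3 := scaleRoots_eval₂_mul (p := G) (aeval x₀ : K[X] →ₐ[K] L).toRingHom
    (ψ (AdjoinRoot.root A) / aeval x₀ a) a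
  have h4 : (aeval x₀ : K[X] →ₐ[K] L).toRingHom a * (ψ (AdjoinRoot.root A) / aeval x₀ a) =
      ψ (AdjoinRoot.root A) := mul_div_cancel₀ _ hψa
  rw [h4, ← h2] at h3
  exact (mul_eq_zero.1 h3.symm).resolve_left (pow_ne_zero _ hψa)

namespace HahnSeries

variable {K : Type*} [Field K]

theorem le_addVal_iff {a : ℚ} {u : HahnSeries ℚ K} :
    (a : WithTop ℚ) ≤ addVal ℚ K u ↔ ∀ b < a, u.coeff b = 0 := by
  rw [addVal_apply]
  constructor
  · intro h b hb
    exact coeff_eq_zero_of_lt_orderTop (lt_of_lt_of_le (WithTop.coe_lt_coe.2 hb) h)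
  · intro h
    by_contra! hlt
    have hu : u ≠ 0 := by rintro rfl; simp at hlt
    obtain ⟨b, hb⟩ := WithTop.ne_top_iff_exists.1 hlt.ne_top
    rw [← hb, WithTop.coe_lt_coe] at hlt
    exact coeff_orderTop_ne hb.symm (h b hlt)

/-- `u` is congruent to the monomial with exponent `a` and coefficient `z`, up to terms of
exponent larger than `a`. -/
def HasLead (a : ℚ) (z : K) (u : HahnSeries ℚ K) : Prop :=
  (a : WithTop ℚ) < addVal ℚ K (u - single a z)

theorem hasLead_zero_iff {a : ℚ} {u : HahnSeries ℚ K} :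
    HasLead a 0 u ↔ (a : WithTop ℚ) < addVal ℚ K u := by
  rw [HasLead, single_eq_zero, sub_zero]

theorem hasLead_single (a : ℚ) (z : K) : HasLead a z (single a z) := by
  rw [HasLead, sub_self, AddValuation.map_zero]
  exact WithTop.coe_lt_top a

theorem le_addVal_single (a : ℚ) (z : K) : (a : WithTop ℚ) ≤ addVal ℚ K (single a z) :=
  le_addVal_iff.2 fun _ hb => coeff_single_of_ne hb.ne

theorem HasLead.le_addVal {a : ℚ} {z : K} {u : HahnSeries ℚ K} (h : HasLead a z u) :
    (a : WithTop ℚ) ≤ addVal ℚ K u := by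
  rw [← sub_add_cancel u (single a z)]
  exact AddValuation.map_le_add _ (le_of_lt h) (le_addVal_single a z)

theorem hasLead_coeff {a : ℚ} {u : HahnSeries ℚ K} (h : (a : WithTop ℚ) ≤ addVal ℚ K u) :
    HasLead a (u.coeff a) u := by
  rw [HasLead]
  by_contra! hle
  have hc : ∀ b ≤ a, (u - single a (u.coeff a)).coeff b = 0 := by
    intro b hb
    rw [coeff_sub]
    rcases hb.lt_or_eq with hb | rfl
    · rw [le_addVal_iff.1 h b hb, coeff_single_of_ne hb.ne, sub_zero]
    · rw [coeff_single_same, sub_self]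
  obtain ⟨b, hb⟩ := WithTop.ne_top_iff_exists.1 (hle.trans_lt (WithTop.coe_lt_top a)).ne
  rw [addVal_apply] at hb
  rw [addVal_apply, ← hb, WithTop.coe_le_coe] at hle
  exact coeff_orderTop_ne hb.symm (hc b hle)

theorem HasLead.of_lt {a b : ℚ} {z : K} {u : HahnSeries ℚ K} (h : HasLead a z u) (hb : b < a) :
    HasLead b 0 u :=
  hasLead_zero_iff.2 (lt_of_lt_of_le (WithTop.coe_lt_coe.2 hb) h.le_addVal)

theorem HasLead.add {a : ℚ} {z w : K} {u t : HahnSeries ℚ K} (h : HasLead a z u)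
    (h' : HasLead a w t) : HasLead a (z + w) (u + t) := by
  have : u + t - single a (z + w) = (u - single a z) + (t - single a w) := by
    rw [single_add]; ring
  rw [HasLead, this]
  exact AddValuation.map_lt_add _ h h'

theorem HasLead.neg {a : ℚ} {z : K} {u : HahnSeries ℚ K} (h : HasLead a z u) :
    HasLead a (-z) (-u) := by
  have : -u - single a (-z) = -(u - single a z) := by
    rw [single_neg]; ring
  rw [HasLead, this, AddValuation.map_neg]
  exact h

theorem HasLead.sub {a : ℚ} {z w : K} {u t : HahnSeries ℚ K} (h : HasLead a z u)
    (h' : HasLead a w t) : HasLead a (z - w) (u - t) := by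
  rw [sub_eq_add_neg, sub_eq_add_neg]
  exact h.add h'.neg

theorem HasLead.mul {a b : ℚ} {z w : K} {u t : HahnSeries ℚ K} (h : HasLead a z u)
    (h' : HasLead b w t) : HasLead (a + b) (z * w) (u * t) := by
  have : u * t - single (a + b) (z * w) =
      single a z * (t - single b w) + (u - single a z) * t := by
    rw [← single_mul_single]; ring
  rw [HasLead, this]
  refine AddValuation.map_lt_add _ ?_ ?_
  · rw [AddValuation.map_mul, WithTop.coe_add]
    exact WithTop.add_lt_add_of_le_of_lt WithTop.coe_ne_top (le_addVal_single a z) h'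
  · rw [AddValuation.map_mul, WithTop.coe_add]
    exact WithTop.add_lt_add_of_lt_of_le WithTop.coe_ne_top h h'.le_addVal

theorem hasLead_one : HasLead 0 (1 : K) 1 := hasLead_single 0 1

theorem HasLead.pow {a : ℚ} {z : K} {u : HahnSeries ℚ K} (h : HasLead a z u) (n : ℕ) :
    HasLead (n * a) (z ^ n) (u ^ n) := by
  induction n with
  | zero => simpa using hasLead_one
  | succ n ih => simpa [pow_succ, add_mul] using ih.mul h

theorem HasLead.sum {ι : Type*} {S : Finset ι} {a : ℚ} {z : ι → K} {u : ι → HahnSeries ℚ K}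
    (h : ∀ i ∈ S, HasLead a (z i) (u i)) : HasLead a (∑ i ∈ S, z i) (∑ i ∈ S, u i) := by
  classical
  induction S using Finset.induction_on with
  | empty => simpa using hasLead_zero_iff.2 (by simp)
  | insert i S hi ih =>
    rw [Finset.sum_insert hi, Finset.sum_insert hi]
    exact (h i (Finset.mem_insert_self _ _)).add
      (ih fun j hj => h j (Finset.mem_insert_of_mem hj))

/-- Pseudo-convergent families of Hahn series have a pseudo-limit. -/
theorem exists_pseudoLimit {C : Set (HahnSeries ℚ K)} {r : HahnSeries ℚ K → ℚ}
    (hC : ∀ a ∈ C, ∀ b ∈ C, (min (r a) (r b) : ℚ) ≤ addVal ℚ K (a - b)) :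
    ∃ s, ∀ a ∈ C, (r a : WithTop ℚ) ≤ addVal ℚ K (s - a) := by
  classical
  have hcongr : ∀ a ∈ C, ∀ b ∈ C, ∀ γ, γ < r a → γ < r b → a.coeff γ = b.coeff γ := by
    intro a ha b hb γ h1 h2
    have := le_addVal_iff.1 (hC a ha b hb) γ (lt_min h1 h2)
    rwa [coeff_sub, sub_eq_zero] at this
  let c : ℚ → K := fun γ => if h : ∃ a ∈ C, γ < r a then h.choose.coeff γ else 0
  have hc : ∀ a ∈ C, ∀ γ, γ < r a → c γ = a.coeff γ := by
    intro a ha γ hγ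
    have h : ∃ a ∈ C, γ < r a := ⟨a, ha, hγ⟩
    simp only [c, dif_pos h]
    exact hcongr _ h.choose_spec.1 _ ha _ h.choose_spec.2 hγ
  have hpwo : (Function.support c).IsPWO := by
    rw [Set.isPWO_iff_isWF, Set.isWF_iff_no_descending_seq]
    intro g hg hmem
    have h0 : ∃ a ∈ C, g 0 < r a := by
      by_contra h
      exact hmem 0 (dif_neg h)
    obtain ⟨a, ha, hlt⟩ := h0
    have hwf := a.isWF_support
    rw [Set.isWF_iff_no_descending_seq] at hwf
    refine hwf g hg fun n => ?_
    have hn : g n < r a := lt_of_le_of_lt (hg.antitone (Nat.zero_le n)) hlt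
    rw [mem_support, ← hc a ha _ hn]
    exact hmem n
  refine ⟨⟨c, hpwo⟩, fun a ha => le_addVal_iff.2 fun γ hγ => ?_⟩
  rw [coeff_sub, sub_eq_zero]
  exact hc a ha γ hγ

theorem exists_eq_of_hasLead {Φ : HahnSeries ℚ K → HahnSeries ℚ K} (N : ℚ ≃o ℚ)
    {ρ : ℚ → K → K} {δ₁ : ℚ} (hδ₁ : 0 ≤ δ₁)
    (hΦ : ∀ s, 0 < addVal ℚ K s → ∀ δ > δ₁, ∀ z u, HasLead δ z u →
      HasLead (N δ) (ρ δ z) (Φ (s + u) - Φ s))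
    (hρ : ∀ δ > δ₁, Function.Surjective (ρ δ)) {s₀ c : HahnSeries ℚ K} (hs₀ : 0 < addVal ℚ K s₀)
    (hc : (N δ₁ : WithTop ℚ) < addVal ℚ K (c - Φ s₀)) :
    ∃ s, (δ₁ : WithTop ℚ) < addVal ℚ K (s - s₀) ∧ Φ s = c := by
  by_contra! hne
  let S := {s : HahnSeries ℚ K // (δ₁ : WithTop ℚ) < addVal ℚ K (s - s₀)}
  have hpos : ∀ s : S, 0 < addVal ℚ K s.1 := fun s => by
    rw [← sub_add_cancel s.1 s₀]
    exact AddValuation.map_lt_add _ (lt_of_le_of_lt (by exact_mod_cast hδ₁) s.2) hs₀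
  have hdiff : ∀ s s' : HahnSeries ℚ K, 0 < addVal ℚ K s → ∀ δ > δ₁,
      (δ : WithTop ℚ) ≤ addVal ℚ K (s' - s) → (N δ : WithTop ℚ) ≤ addVal ℚ K (Φ s' - Φ s) := by
    intro s s' hs δ hδ h
    have := (hΦ s hs δ hδ _ _ (hasLead_coeff h)).le_addVal
    rwa [add_sub_cancel] at this
  have hS : ∀ s : S, ∃ r : ℚ, δ₁ < r ∧ addVal ℚ K (c - Φ s.1) = N r := by
    intro s
    have h0 : addVal ℚ K (c - Φ s.1) ≠ ⊤ := by
      rw [Ne, AddValuation.top_iff, sub_eq_zero]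
      exact fun h => hne s.1 s.2 h.symm
    obtain ⟨g, hg⟩ := WithTop.ne_top_iff_exists.1 h0
    refine ⟨N.symm g, ?_, by rw [N.apply_symm_apply, hg]⟩
    obtain ⟨δ, hδ, hδ'⟩ : ∃ δ > δ₁, (δ : WithTop ℚ) ≤ addVal ℚ K (s.1 - s₀) := by
      have h := s.2
      rcases eq_or_ne (addVal ℚ K (s.1 - s₀)) ⊤ with h' | h'
      · exact ⟨δ₁ + 1, by linarith, by rw [h']; exact le_top⟩
      · obtain ⟨δ, hδ⟩ := WithTop.ne_top_iff_exists.1 h'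
        rw [← hδ, WithTop.coe_lt_coe] at h
        exact ⟨δ, h, hδ.le⟩
    have h1 : (N δ₁ : WithTop ℚ) < addVal ℚ K (c - Φ s.1) := by
      have h2 := hdiff s₀ s.1 hs₀ δ hδ hδ'
      have h3 : c - Φ s.1 = (c - Φ s₀) - (Φ s.1 - Φ s₀) := by ring
      rw [h3, sub_eq_add_neg]
      refine AddValuation.map_lt_add _ hc ?_
      rw [AddValuation.map_neg]
      exact lt_of_lt_of_le (WithTop.coe_lt_coe.2 (N.lt_iff_lt.2 hδ)) h2
    rw [← hg, WithTop.coe_lt_coe] at h1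
    rwa [← N.lt_iff_lt, N.apply_symm_apply]
  choose r hr₁ hr using hS
  let rel : S → S → Prop := fun a b => (r a : WithTop ℚ) ≤ addVal ℚ K (b.1 - a.1) ∧ r a ≤ r b
  have hle : ∀ a b : S, (r a : WithTop ℚ) ≤ addVal ℚ K (b.1 - a.1) → rel a b := by
    intro a b hab
    refine ⟨hab, ?_⟩
    have h1 := hdiff a.1 b.1 (hpos a) (r a) (hr₁ a) hab
    have h2 : c - Φ b.1 = (c - Φ a.1) - (Φ b.1 - Φ a.1) := by ring
    have h3 : (N (r a) : WithTop ℚ) ≤ addVal ℚ K (c - Φ b.1) := by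
      rw [h2]
      exact AddValuation.map_le_sub _ (hr a).ge h1
    rw [hr b, WithTop.coe_le_coe] at h3
    exact N.le_iff_le.1 h3
  obtain ⟨m, hm⟩ : ∃ m : S, ∀ a, rel m a → rel a m := by
    refine exists_maximal_of_chains_bounded (fun C hC => ?_) ?_
    · rcases C.eq_empty_or_nonempty with rfl | ⟨a₀, ha₀⟩
      · exact ⟨⟨s₀, by simp⟩, by simp⟩
      · classical
        let r' : HahnSeries ℚ K → ℚ := fun s => if h : (δ₁ : WithTop ℚ) < addVal ℚ K (s - s₀) then
          r ⟨s, h⟩ else 0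
        have hr' : ∀ a : S, r' a.1 = r a := fun a => dif_pos a.2
        obtain ⟨s, hs⟩ := exists_pseudoLimit (C := Subtype.val '' C) (r := r') (by
          rintro _ ⟨a, ha, rfl⟩ _ ⟨b, hb, rfl⟩
          rw [hr', hr']
          rcases eq_or_ne a b with rfl | hab
          · simp
          · rcases hC ha hb hab with h | h
            · rw [AddValuation.map_sub_swap]
              exact le_trans (WithTop.coe_le_coe.2 (min_le_left _ _)) h.1
            · exact le_trans (WithTop.coe_le_coe.2 (min_le_right _ _)) h.1)
        have hs' : ∀ a ∈ C, (r a : WithTop ℚ) ≤ addVal ℚ K (s - a.1) := fun a ha => by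
          rw [← hr']; exact hs _ ⟨a, ha, rfl⟩
        have hmem : (δ₁ : WithTop ℚ) < addVal ℚ K (s - s₀) := by
          have : s - s₀ = (s - a₀.1) + (a₀.1 - s₀) := by ring
          rw [this]
          exact AddValuation.map_lt_add _
            (lt_of_lt_of_le (WithTop.coe_lt_coe.2 (hr₁ a₀)) (hs' a₀ ha₀)) a₀.2
        exact ⟨⟨s, hmem⟩, fun a ha => hle _ _ (hs' a ha)⟩
    · rintro a b d ⟨h1, h2⟩ ⟨h3, h4⟩
      refine ⟨?_, h2.trans h4⟩
      have : d.1 - a.1 = (d.1 - b.1) + (b.1 - a.1) := by ring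
      rw [this]
      exact AddValuation.map_le_add _ (le_trans (WithTop.coe_le_coe.2 h2) h3) h1
  obtain ⟨z, hz⟩ := hρ (r m) (hr₁ m) ((c - Φ m.1).coeff (N (r m)))
  have h1 := hΦ m.1 (hpos m) (r m) (hr₁ m) z _ (hasLead_single (r m) z)
  have h2 := (hasLead_coeff (hr m).ge).sub h1
  rw [hz, sub_self, sub_sub_sub_cancel_right] at h2
  have hmem : (δ₁ : WithTop ℚ) < addVal ℚ K (m.1 + single (r m) z - s₀) := by
    have : m.1 + single (r m) z - s₀ = (m.1 - s₀) + single (r m) z := by ring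
    rw [this]
    exact AddValuation.map_lt_add _ m.2
      (lt_of_lt_of_le (WithTop.coe_lt_coe.2 (hr₁ m)) (le_addVal_single _ _))
  have h3 := (hm ⟨_, hmem⟩ (hle _ _ (by
    rw [add_sub_cancel_left]; exact le_addVal_single _ _))).2
  have h4 := hasLead_zero_iff.1 h2
  have h5 := hr ⟨_, hmem⟩
  rw [h5, WithTop.coe_lt_coe, N.lt_iff_lt] at h4
  exact absurd h3 (not_le.2 h4)

section Lines

variable {ι : Type*} {S : Finset ι}

/-- The minimum of the lines of slope `2 ^ e i` and intercept `a i`. -/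
def minLine (hS : S.Nonempty) (a : ι → ℚ) (e : ι → ℕ) (δ : ℚ) : ℚ :=
  S.inf' hS fun i => a i + 2 ^ e i * δ

theorem minLine_strictMono (hS : S.Nonempty) (a : ι → ℚ) (e : ι → ℕ) :
    StrictMono (minLine hS a e) := by
  intro δ δ' h
  rw [minLine, minLine, Finset.lt_inf'_iff]
  intro i hi
  refine lt_of_le_of_lt (Finset.inf'_le _ hi) ?_
  have : (0 : ℚ) < 2 ^ e i := by positivity
  nlinarith

theorem minLine_surjective (hS : S.Nonempty) (a : ι → ℚ) (e : ι → ℕ) :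
    Function.Surjective (minLine hS a e) := by
  intro g
  refine ⟨S.sup' hS fun i => (g - a i) / 2 ^ e i, le_antisymm ?_ ?_⟩
  · obtain ⟨i, hi, h⟩ := S.exists_mem_eq_sup' hS fun i => (g - a i) / 2 ^ e i
    rw [h]
    refine (Finset.inf'_le _ hi).trans_eq ?_
    field_simp
    ring
  · refine Finset.le_inf' _ _ fun i hi => ?_
    have h := Finset.le_sup' (fun i => (g - a i) / 2 ^ e i) hi
    rw [div_le_iff₀' (by positivity)] at h
    linarith

variable {K : Type*} [Field K]

/-- The sum of the monomials `c i * z ^ 2 ^ e i` whose line attains the minimum at `δ`. -/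
def leadMap (hS : S.Nonempty) (a : ι → ℚ) (e : ι → ℕ) (c : ι → K) (δ : ℚ) (z : K) : K :=
  ∑ i ∈ S with a i + 2 ^ e i * δ = minLine hS a e δ, c i * z ^ 2 ^ e i

theorem leadMap_sub [CharP K 2] (hS : S.Nonempty) (a : ι → ℚ) (e : ι → ℕ) (c : ι → K) (δ : ℚ)
    (z w : K) :
    leadMap hS a e c δ (z - w) = leadMap hS a e c δ z - leadMap hS a e c δ w := by
  simp only [leadMap, ← Finset.sum_sub_distrib, ← mul_sub, sub_pow_char_pow]

theorem finite_leadMap_ker (hS : S.Nonempty) {a : ι → ℚ} (e : ι → ℕ) {c : ι → K}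
    (ha : Set.InjOn a S) (hc : ∀ i ∈ S, c i ≠ 0) :
    {δ : ℚ | ∃ z ≠ 0, leadMap hS a e c δ z = 0}.Finite := by
  refine Set.Finite.subset ((S ×ˢ S).image fun p =>
    (a p.2 - a p.1) / (2 ^ e p.1 - 2 ^ e p.2)).finite_toSet ?_
  rintro δ ⟨z, hz, h⟩
  obtain ⟨i, hi, hmin⟩ := S.exists_mem_eq_inf' hS fun i => a i + 2 ^ e i * δ
  obtain ⟨j, hj, hij⟩ : ∃ j ∈ S.filter (fun i => a i + 2 ^ e i * δ = minLine hS a e δ), j ≠ i := by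
    by_contra! hne
    rw [leadMap, Finset.sum_eq_single_of_mem i (Finset.mem_filter.2 ⟨hi, hmin.symm⟩)
      fun j hj hji => absurd (hne j hj) hji] at h
    exact mul_ne_zero (hc i hi) (pow_ne_zero _ hz) h
  obtain ⟨hjS, hj⟩ := Finset.mem_filter.1 hj
  rw [minLine, hmin] at hj
  have hne : (2 : ℚ) ^ e i - 2 ^ e j ≠ 0 := fun h0 =>
    hij (ha hjS hi (by linear_combination hj + δ * h0))
  rw [Finset.coe_image, Set.mem_image]
  refine ⟨(i, j), by simp [hi, hjS], ?_⟩
  rw [div_eq_iff hne]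
  linear_combination hj

theorem hasLead_sum_minLine (hS : S.Nonempty) (a : ι → ℚ) (e : ι → ℕ) (c : ι → K) (δ : ℚ) (z : K)
    {T : ι → HahnSeries ℚ K}
    (hT : ∀ i ∈ S, HasLead (a i + 2 ^ e i * δ) (c i * z ^ 2 ^ e i) (T i)) :
    HasLead (minLine hS a e δ) (leadMap hS a e c δ z) (∑ i ∈ S, T i) := by
  rw [leadMap, Finset.sum_filter]
  refine HasLead.sum fun i hi => ?_
  split_ifs with h
  · exact h ▸ hT i hi
  · exact (hT i hi).of_lt (lt_of_le_of_ne (Finset.inf'_le _ hi) (Ne.symm h))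

theorem exists_root_or_exists_eq [Finite K] [CharP K 2] (hS : S.Nonempty) {a : ι → ℚ}
    {e : ι → ℕ} {c : ι → K} (ha : Set.InjOn a S) (hc : ∀ i ∈ S, c i ≠ 0)
    {Φ : HahnSeries ℚ K → HahnSeries ℚ K} (hΦ₀ : Φ 0 = 0)
    (hΦ : ∀ s, 0 < addVal ℚ K s → ∀ δ > 0, ∀ z u, HasLead δ z u →
      HasLead (minLine hS a e δ) (leadMap hS a e c δ z) (Φ (s + u) - Φ s))
    {t : HahnSeries ℚ K} (ht : (minLine hS a e 0 : WithTop ℚ) < addVal ℚ K t) :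
    (∃ s, s ≠ 0 ∧ Φ s = 0) ∨ ∃ s, 0 < addVal ℚ K s ∧ Φ s = t := by
  let N : ℚ ≃o ℚ := (minLine_strictMono hS a e).orderIsoOfSurjective _ (minLine_surjective hS a e)
  have hzero : (0 : WithTop ℚ) < addVal ℚ K 0 := by simp
  have hsurj : ∀ δ, ¬ (∃ z ≠ 0, leadMap hS a e c δ z = 0) →
      Function.Surjective (leadMap hS a e c δ) := by
    intro δ h
    refine Finite.surjective_of_injective fun z w hzw => ?_
    by_contra hne
    exact h ⟨z - w, sub_ne_zero.2 hne, by rw [leadMap_sub, hzw, sub_self]⟩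
  let D := {δ : ℚ | 0 < δ ∧ ∃ z ≠ 0, leadMap hS a e c δ z = 0}
  have hD : D.Finite := (finite_leadMap_ker hS e ha hc).subset fun δ h => h.2
  rcases D.eq_empty_or_nonempty with h | h
  · right
    obtain ⟨s, hs, hs'⟩ := exists_eq_of_hasLead N le_rfl hΦ
      (fun δ hδ => hsurj δ fun h' => (h.subset (show δ ∈ D from ⟨hδ, h'⟩))) hzero
      (c := t) (by rw [hΦ₀, sub_zero]; exact ht)
    exact ⟨s, by simpa using hs, hs'⟩
  · left
    obtain ⟨δ₁, ⟨hδ₁, z, hz, hz₀⟩, hmax⟩ := hD.exists_maximal h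
    have hs₀ : HasLead δ₁ z (single δ₁ z) := hasLead_single δ₁ z
    have hΦs := hΦ 0 hzero δ₁ hδ₁ z _ hs₀
    rw [zero_add, hΦ₀, sub_zero, hz₀, hasLead_zero_iff] at hΦs
    have hs₀' : (0 : WithTop ℚ) < addVal ℚ K (single δ₁ z) :=
      lt_of_lt_of_le (by exact_mod_cast hδ₁) hs₀.le_addVal
    obtain ⟨s, hs, hs'⟩ := exists_eq_of_hasLead N hδ₁.le
      (fun s hs δ hδ => hΦ s hs δ (hδ₁.trans hδ))
      (fun δ hδ => hsurj δ fun h' =>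
        absurd (hmax (show δ ∈ D from ⟨hδ₁.trans hδ, h'⟩) (le_of_lt hδ)) (not_le.2 hδ)) hs₀'
      (c := 0) (by rw [zero_sub, AddValuation.map_neg]; exact hΦs)
    refine ⟨s, ?_, hs'⟩
    rintro rfl
    rw [zero_sub, AddValuation.map_neg, addVal_apply, orderTop_single hz] at hs
    exact lt_irrefl _ hs

end Lines

variable {K : Type*} [Field K]

theorem HasLead.pow_add_sub_pow {w z : K} {s u : HahnSeries ℚ K} {δ : ℚ} (hδ : 0 < δ)
    (hs : HasLead 0 w s) (hu : HasLead δ z u) (j : ℕ) :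
    HasLead δ (j * w ^ (j - 1) * z) ((s + u) ^ j - s ^ j) := by
  have h := (Commute.all (s + u) s).geom_sum₂_mul j
  rw [add_sub_cancel_left] at h
  rw [← h, ← zero_add δ]
  refine HasLead.mul ?_ hu
  have hsu : HasLead 0 w (s + u) := by simpa using hs.add (hu.of_lt hδ)
  have hsum : (j * w ^ (j - 1) : K) = ∑ i ∈ Finset.range j, w ^ i * w ^ (j - 1 - i) := by
    have hterm : ∀ i ∈ Finset.range j, w ^ i * w ^ (j - 1 - i) = w ^ (j - 1) := fun i hi => by
      rw [← _root_.pow_add, Nat.add_sub_cancel' (by have := Finset.mem_range.1 hi; omega)]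
    rw [Finset.sum_congr rfl hterm, Finset.sum_const, Finset.card_range, nsmul_eq_mul]
  rw [hsum]
  exact HasLead.sum fun i _ => by simpa using (hsu.pow i).mul (hs.pow (j - 1 - i))

theorem hasLead_algebraMap (c : K) : HasLead 0 c (algebraMap K (HahnSeries ℚ K) c) := by
  rw [algebraMap_apply', PowerSeries.algebraMap_apply, Algebra.algebraMap_self_apply,
    ofPowerSeries_C]
  exact hasLead_single 0 c

instance [CharP K 2] : CharP (HahnSeries ℚ K) 2 :=
  charP_of_injective_algebraMap (algebraMap K (HahnSeries ℚ K)).injective 2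

theorem HasLead.shifted_pow_sub [CharP K 2] {z : K} {s u : HahnSeries ℚ K} {δ : ℚ} (hδ : 0 < δ)
    (hs : 0 < addVal ℚ K s) (hu : HasLead δ z u) (e : ℕ) {j : ℕ} (hj : Odd j) (hj₂ : 2 ≤ j) :
    HasLead (2 ^ e * δ) (z ^ 2 ^ e)
      ((1 + (s + u)) ^ (2 ^ e * j) + (s + u) ^ (2 ^ e * j) -
        ((1 + s) ^ (2 ^ e * j) + s ^ (2 ^ e * j))) := by
  have hs₀ : HasLead 0 (0 : K) s := hasLead_zero_iff.2 hs
  have h1s : HasLead 0 (1 : K) (1 + s) := by simpa using hasLead_one.add hs₀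
  have h := ((h1s.pow_add_sub_pow hδ hu j).add (hs₀.pow_add_sub_pow hδ hu j)).pow (2 ^ e)
  have hjK : (j : K) = 1 := by
    obtain ⟨k, rfl⟩ := hj
    simp [CharTwo.two_eq_zero]
  rw [hjK, one_pow, one_mul, one_mul, one_mul, zero_pow (by omega), zero_mul, add_zero,
    add_pow_char_pow, sub_pow_char_pow, sub_pow_char_pow] at h
  simp only [← pow_mul, mul_comm j] at h
  convert h using 1
  · push_cast; rfl
  · ring

theorem exists_add_eq_zero [Finite K] [CharP K 2] {g : K[X]} (hg₂ : g.coeff 2 = 1)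
    (hg : ∀ i ∈ g.support, i ≠ 2 → ∃ e j, Odd j ∧ 2 ≤ j ∧ i = 2 ^ e * j)
    (hg₃ : ∃ i ∈ g.support, 3 ≤ i) :
    ∃ y : HahnSeries ℚ K, y ≠ 0 ∧ aeval (single (-1 : ℚ) (1 : K) + y) g + aeval y g +
      aeval (single (-1 : ℚ) (1 : K)) g + single (-1 : ℚ) (1 : K) * y = 0 := by
  classical
  set x : HahnSeries ℚ K := single (-1 : ℚ) (1 : K) with hx
  have hx₀ : x ≠ 0 := single_ne_zero one_ne_zero
  have hS : g.support.Nonempty := hg₃.imp fun i h => h.1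
  have h2S : 2 ∈ g.support := by rw [mem_support_iff, hg₂]; exact one_ne_zero
  have hg' : ∀ i, ∃ e, i ∈ g.support →
      (i = 2 ∧ e = 0) ∨ (i ≠ 2 ∧ ∃ j, Odd j ∧ 2 ≤ j ∧ i = 2 ^ e * j) := by
    intro i
    by_cases hi : i ∈ g.support
    · by_cases h2 : i = 2
      · exact ⟨0, fun _ => Or.inl ⟨h2, rfl⟩⟩
      · obtain ⟨e, j, h⟩ := hg i hi h2
        exact ⟨e, fun _ => Or.inr ⟨h2, j, h⟩⟩
    · exact ⟨0, fun h => absurd h hi⟩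
  choose e he using hg'
  let a : ℕ → ℚ := fun i => -i
  let P : ℕ → HahnSeries ℚ K → HahnSeries ℚ K := fun i s =>
    if i = 2 then s else (1 + s) ^ i + s ^ i + 1
  let Φ : HahnSeries ℚ K → HahnSeries ℚ K := fun s =>
    ∑ i ∈ g.support, algebraMap K _ (g.coeff i) * x ^ i * P i s
  have hmono : ∀ i, HasLead (a i) (g.coeff i) (algebraMap K _ (g.coeff i) * x ^ i) := by
    intro i
    have h0 : HasLead 0 (g.coeff i) (algebraMap K (HahnSeries ℚ K) (g.coeff i)) :=
      hasLead_algebraMap _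
    have h := h0.mul ((hasLead_single (-1 : ℚ) (1 : K)).pow i)
    rwa [one_pow, mul_one, zero_add, mul_neg, mul_one] at h
  have hP : ∀ i ∈ g.support, ∀ s, 0 < addVal ℚ K s → ∀ δ > 0, ∀ z u, HasLead δ z u →
      HasLead (2 ^ e i * δ) (z ^ 2 ^ e i) (P i (s + u) - P i s) := by
    intro i hi s hs δ hδ z u hu
    rcases he i hi with ⟨rfl, h⟩ | ⟨h2, j, hj, hj₂, h⟩
    · simpa [P, h] using hu
    · simp only [P, if_neg h2, add_sub_add_right_eq_sub]
      have := HasLead.shifted_pow_sub hδ hs hu (e i) hj hj₂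
      rwa [← h] at this
  have hΦ₀ : Φ 0 = 0 := by
    refine Finset.sum_eq_zero fun i hi => ?_
    rcases he i hi with ⟨rfl, -⟩ | ⟨h2, j, hj, hj₂, h⟩
    · simp [P]
    · have : i ≠ 0 := by rw [h]; positivity
      simp [P, h2, this, CharTwo.add_self_eq_zero]
  have hΦ : ∀ s, 0 < addVal ℚ K s → ∀ δ > 0, ∀ z u, HasLead δ z u →
      HasLead (minLine hS a e δ) (leadMap hS a e g.coeff δ z) (Φ (s + u) - Φ s) := by
    intro s hs δ hδ z u hu
    rw [← Finset.sum_sub_distrib]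
    refine hasLead_sum_minLine hS a e g.coeff δ z fun i hi => ?_
    rw [← mul_sub]
    exact (hmono i).mul (hP i hi s hs δ hδ z u hu)
  have hΦeq : ∀ s, Φ s = aeval (x + x * s) g + aeval (x * s) g + aeval x g + x * (x * s) := by
    intro s
    have hlast : x * (x * s) = ∑ i ∈ g.support, if i = 2 then x * (x * s) else 0 := by
      rw [Finset.sum_ite_eq' g.support 2, if_pos h2S]
    simp only [aeval_def, eval₂_eq_sum, Polynomial.sum]
    rw [hlast, ← Finset.sum_add_distrib, ← Finset.sum_add_distrib, ← Finset.sum_add_distrib]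
    refine Finset.sum_congr rfl fun i _ => ?_
    simp only [P]
    split_ifs with h
    · rw [h, hg₂, map_one]
      linear_combination -(x ^ 2 + x ^ 2 * s + x ^ 2 * s ^ 2) *
        CharTwo.two_eq_zero (R := HahnSeries ℚ K)
    · have : x + x * s = x * (1 + s) := by ring
      rw [this, mul_pow, mul_pow]
      ring
  have hx2 : (minLine hS a e 0 : WithTop ℚ) < addVal ℚ K (x ^ 2) := by
    obtain ⟨i, hi, hi₃⟩ := hg₃
    refine lt_of_lt_of_le (b := ((-2 : ℚ) : WithTop ℚ)) (WithTop.coe_lt_coe.2 ?_) ?_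
    · refine lt_of_le_of_lt (Finset.inf'_le _ hi) ?_
      have : (3 : ℚ) ≤ i := by exact_mod_cast hi₃
      simp only [a]
      linarith
    · have h := ((hasLead_single (-1 : ℚ) (1 : K)).pow 2).le_addVal
      rw [Nat.cast_ofNat, mul_neg, mul_one] at h
      exact h
  rcases exists_root_or_exists_eq hS (fun i _ j _ h => by simpa [a] using h)
    (fun i hi => mem_support_iff.1 hi) hΦ₀ hΦ hx2 with ⟨s, hs, h⟩ | ⟨s, hs, h⟩
  · exact ⟨x * s, mul_ne_zero hx₀ hs, by rw [← hΦeq, h]⟩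
  · refine ⟨x + x * s, fun h0 => ?_, ?_⟩
    · have h1 : x * (1 + s) = 0 := by rw [← h0]; ring
      have h2 : 1 + s = 0 := (mul_eq_zero.1 h1).resolve_left hx₀
      rw [eq_neg_of_add_eq_zero_right h2, AddValuation.map_neg, AddValuation.map_one] at hs
      exact lt_irrefl _ hs
    · have h1 : x + (x + x * s) = x * s := by
        rw [← add_assoc, CharTwo.add_self_eq_zero, zero_add]
      rw [hΦeq] at h
      rw [h1]
      linear_combination h + CharTwo.add_self_eq_zero (x ^ 2)

end HahnSeries

theorem HahnSeries.transcendental_single {K : Type*} [Field K] :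
    Transcendental K (single (-1 : ℚ) (1 : K)) := by
  rw [transcendental_iff]
  intro p hp
  by_contra hne
  have hlead : HasLead (-(p.natDegree : ℚ)) p.leadingCoeff (aeval (single (-1 : ℚ) (1 : K)) p) := by
    have hsum : p.leadingCoeff = ∑ i ∈ Finset.range (p.natDegree + 1),
        if i = p.natDegree then p.leadingCoeff else 0 := by simp
    rw [aeval_def, eval₂_eq_sum_range, hsum]
    refine HasLead.sum fun i hi => ?_
    have h := (hasLead_algebraMap (p.coeff i)).mul
      ((hasLead_single (-1 : ℚ) (1 : K)).pow i)
    rw [one_pow, mul_one, zero_add, mul_neg, mul_one] at h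
    split_ifs with hn
    · rwa [hn] at h ⊢
    · refine h.of_lt (neg_lt_neg ?_)
      have := Finset.mem_range.1 hi
      exact_mod_cast (by omega : i < p.natDegree)
  rw [hp, HasLead, zero_sub, AddValuation.map_neg, addVal_apply,
    orderTop_single (Polynomial.leadingCoeff_ne_zero.2 hne)] at hlead
  exact lt_irrefl _ hlead

section Polarization

variable {K R : Type*} [Field K] [CommRing R] [Algebra K R]

/-- The polarization `f (a + b) + f a + f b`, as a linear function of the polynomial `f`. -/
noncomputable def polarization (a b : R) : K[X] →ₗ[K] R :=
  (aeval (a + b)).toLinearMap + (aeval a).toLinearMap + (aeval b).toLinearMap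

theorem polarization_apply (a b : R) (f : K[X]) :
    polarization a b f = aeval (a + b) f + aeval a f + aeval b f := rfl

theorem polarization_monomial_two_pow [CharP R 2] (a b : R) (k : ℕ) (c : K) :
    polarization a b (monomial (2 ^ k) c) = 0 := by
  rw [polarization_apply, aeval_monomial, aeval_monomial, aeval_monomial, add_pow_char_pow]
  linear_combination algebraMap K R c * (a ^ 2 ^ k + b ^ 2 ^ k) * CharTwo.two_eq_zero (R := R)

open Classical in
/-- The polynomial obtained from `f` by replacing its affine part, that is, its constant term and
its monomials with exponent a power of two, by `X ^ 2`. -/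
noncomputable def normalizeAffinePart (f : K[X]) : K[X] :=
  X ^ 2 + ∑ i ∈ f.support with i ≠ 0 ∧ ¬ ∃ k, i = 2 ^ k, monomial i (f.coeff i)

theorem polarization_normalizeAffinePart [CharP R 2] (a b : R) (f : K[X]) :
    polarization a b f =
      polarization a b (normalizeAffinePart f) + algebraMap K R (f.coeff 0) := by
  classical
  have h2 : polarization a b (X ^ 2 : K[X]) = 0 := by
    rw [← monomial_one_right_eq_X_pow]
    exact polarization_monomial_two_pow a b 1 1
  have h0 : algebraMap K R (f.coeff 0) =
      ∑ i ∈ f.support, if i = 0 then algebraMap K R (f.coeff 0) else 0 := by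
    rw [Finset.sum_ite_eq']
    split_ifs with h
    · rfl
    · rw [notMem_support_iff.1 h, map_zero]
  rw [normalizeAffinePart, map_add, h2, zero_add, map_sum, Finset.sum_filter, h0,
    ← Finset.sum_add_distrib]
  conv_lhs => rw [f.as_sum_support, map_sum]
  refine Finset.sum_congr rfl fun i _ => ?_
  rcases eq_or_ne i 0 with rfl | hi
  · rw [if_neg (by simp), if_pos rfl, zero_add, polarization_apply, aeval_monomial, aeval_monomial,
      aeval_monomial]
    linear_combination algebraMap K R (f.coeff 0) * CharTwo.two_eq_zero (R := R)
  · by_cases h : ∃ k, i = 2 ^ k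
    · obtain ⟨k, rfl⟩ := h
      rw [polarization_monomial_two_pow]
      simp
    · simp [hi, h]

open Classical in
theorem coeff_normalizeAffinePart (f : K[X]) (i : ℕ) :
    (normalizeAffinePart f).coeff i = (if i = 2 then 1 else 0) +
      if i ≠ 0 ∧ ¬ ∃ k, i = 2 ^ k then f.coeff i else 0 := by
  rw [normalizeAffinePart, coeff_add, coeff_X_pow, finsetSum_coeff]
  congr 1
  simp only [coeff_monomial]
  rw [Finset.sum_ite_eq']
  by_cases h : i ∈ f.support
  · simp [h]
  · simp [notMem_support_iff.1 h]

/-- The bivariate polynomial `g (X + Y) + g X + g Y + X * Y`. -/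
noncomputable def bivariatePolarization (g : K[X]) : K[X][X] :=
  polarization (R := K[X][X]) (C X) X g + C X * X

theorem eval₂_bivariatePolarization (g : K[X]) (x y : R) :
    eval₂ (aeval x : K[X] →ₐ[K] R).toRingHom y (bivariatePolarization g) =
      polarization x y g + x * y := by
  have hcomp : (eval₂RingHom (aeval x : K[X] →ₐ[K] R).toRingHom y).comp (algebraMap K K[X][X]) =
      algebraMap K R := by
    ext c
    simp [Polynomial.algebraMap_apply]
  have haeval : ∀ t : K[X][X], eval₂RingHom (aeval x : K[X] →ₐ[K] R).toRingHom y (aeval t g) =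
      aeval (eval₂RingHom (aeval x : K[X] →ₐ[K] R).toRingHom y t) g := by
    intro t
    rw [aeval_def, hom_eval₂, hcomp, aeval_def]
  rw [← coe_eval₂RingHom, bivariatePolarization, polarization_apply, map_add, map_add, map_add,
    haeval, haeval, haeval, map_add, map_mul, polarization_apply]
  simp

end Polarization

theorem exists_zero_polarization_add_mul {K : Type*} [Field K] [Fintype K] [CharP K 2] {f : K[X]}
    {i : ℕ} (hi : f.coeff i ≠ 0) (hi₀ : i ≠ 0) (hpow : ¬ ∃ k, i = 2 ^ k) :
    ∃ r₀, ∀ (L : Type) [Field L] [Fintype L] [Algebra K L], r₀ ≤ Module.finrank K L →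
      ∃ a b : L, a ≠ 0 ∧ b ≠ 0 ∧ polarization a b f + a * b = algebraMap K L (f.coeff 0) := by
  set g := normalizeAffinePart f with hg
  have hgcoeff : ∀ j ≠ 2, g.coeff j ≠ 0 → j ≠ 0 ∧ ¬ ∃ k, j = 2 ^ k := by
    intro j hj h
    by_contra hne
    rw [hg, coeff_normalizeAffinePart, if_neg hj, if_neg hne, add_zero] at h
    exact h rfl
  have hi₂ : i ≠ 2 := by
    rintro rfl
    exact hpow ⟨1, rfl⟩
  have hi₁ : i ≠ 1 := by
    rintro rfl
    exact hpow ⟨0, rfl⟩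
  have hgi : i ∈ g.support := by
    rw [mem_support_iff, hg, coeff_normalizeAffinePart, if_neg hi₂, if_pos ⟨hi₀, hpow⟩, zero_add]
    exact hi
  have hg₂ : g.coeff 2 = 1 := by
    rw [hg, coeff_normalizeAffinePart, if_pos rfl, if_neg fun h => h.2 ⟨1, rfl⟩, add_zero]
  obtain ⟨y, hy, hxy⟩ := HahnSeries.exists_add_eq_zero hg₂ (fun j hj hj₂ => by
    obtain ⟨hj₀, hjpow⟩ := hgcoeff j hj₂ (mem_support_iff.1 hj)
    obtain ⟨e, m, hm, rfl⟩ := Nat.exists_eq_two_pow_mul_odd hj₀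
    refine ⟨e, m, hm, ?_, rfl⟩
    by_contra hlt
    have hm₁ : m = 1 := by
      have := hm.pos
      omega
    exact hjpow ⟨e, by rw [hm₁, mul_one]⟩) ⟨i, hgi, by omega⟩
  have hG : bivariatePolarization g ≠ 0 := by
    intro h
    have h1 := eval₂_bivariatePolarization g (1 : K) 1
    have hg₀ : g.coeff 0 = 0 := by
      by_contra hne
      exact (hgcoeff 0 (by norm_num) hne).1 rfl
    rw [h, eval₂_zero, polarization_apply, add_assoc (aeval _ g), CharTwo.add_self_eq_zero,
      CharTwo.add_self_eq_zero, ← coeff_zero_eq_aeval_zero, hg₀] at h1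
    simp at h1
  obtain ⟨r₀, hr₀⟩ := exists_root_finite_extension (HahnSeries.addVal ℚ K)
    (fun t ht => ⟨t.coeff 0, by
      have h := HahnSeries.hasLead_coeff (a := 0) ht
      have h' := h.sub (HahnSeries.hasLead_algebraMap (t.coeff 0))
      rw [sub_self] at h'
      exact HahnSeries.hasLead_zero_iff.1 h'⟩) HahnSeries.transcendental_single hy hG
    (by rw [eval₂_bivariatePolarization, polarization_apply, ← hxy]; ring)
  refine ⟨r₀, fun L _ _ _ hL => ?_⟩
  obtain ⟨a, b, ha, hb, hab⟩ := hr₀ L hL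
  have : CharP L 2 := charP_of_injective_algebraMap (algebraMap K L).injective 2
  rw [eval₂_bivariatePolarization] at hab
  exact ⟨a, b, ha, hb, by
    rw [polarization_normalizeAffinePart]; linear_combination hab⟩

end

theorem exceptional_planar_is_two_polynomial
    {K : Type*} [Field K] [Fintype K] (n : ℕ) (hn : 1 ≤ n)
    (hcard : Fintype.card K = 2 ^ n)
    (f : Polynomial K)
    (hexc : {r : ℕ | 0 < r ∧ ∃ (L : Type) (_ : Field L) (_ : Fintype L) (_ : Algebra K L),
        Module.finrank K L = r ∧
        ∀ ε : L, ε ≠ 0 → Function.Bijective fun x : L =>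
          (f.map (algebraMap K L)).eval (x + ε) + (f.map (algebraMap K L)).eval x + ε * x}.Infinite) :
    ∀ i : ℕ, 1 ≤ i → f.coeff i ≠ 0 → ∃ k : ℕ, i = 2 ^ k := by
  intro i hi hfi
  by_contra hpow
  have : CharP K 2 := charP_of_card_eq_prime_pow hcard
  obtain ⟨r₀, hr₀⟩ := exists_zero_polarization_add_mul hfi (by omega) hpow
  obtain ⟨r, ⟨-, L, _, _, _, hr, hbij⟩, hlt⟩ := hexc.exists_gt r₀
  obtain ⟨a, b, ha, hb, hab⟩ := hr₀ L (by omega)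
  refine hb ((hbij a ha).injective ?_)
  have : CharP L 2 := charP_of_injective_algebraMap (algebraMap K L).injective 2
  rw [polarization_apply] at hab
  have h0 : Polynomial.aeval (0 : L) f = algebraMap K L (f.coeff 0) :=
    (Polynomial.coeff_zero_eq_aeval_zero' f).symm
  simp only [Polynomial.eval_map_algebraMap, h0, zero_add, mul_zero, add_zero, add_comm b a]
  linear_combination hab - Polynomial.aeval a f * CharTwo.two_eq_zero (R := L)
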